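/- arXiv:1104.5472 — 2 statements merged into one kernel-verified Lean document; each statement's English description precedes it below -/
import Mathlib

section
/- Let σ be an involution of g with Z₂-grading g = g₀ ⊕ g₁. Then g₁ contains a regular semisimple element of g if and only if g₁ contains a regular nilpotent element of g. -/
open LieAlgebra Module

variable (k : Type*) [Field k] [IsAlgClosed k] [CharZero k]
variable (g : Type*) [LieRing g] [LieAlgebra k g] [FiniteDimensional k g]
  [LieAlgebra.IsSemisimple k g]

/-- The eigenspace of a Lie algebra automorphism `σ` for the eigenvalue `c`. -/
noncomputable def eigSub (σ : g ≃ₗ⁅k⁆ g) (c : k) : Submodule k g :=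
  Module.End.eigenspace (σ.toLinearEquiv : g →ₗ[k] g) c

/-- A Lie algebra involution: an automorphism `σ` with `σ ∘ σ = id`. -/
def IsInvolution (σ : g ≃ₗ⁅k⁆ g) : Prop := ∀ x, σ (σ x) = x

/-- Two commuting involutions. -/
def CommutingInvolutions (σ₁ σ₂ : g ≃ₗ⁅k⁆ g) : Prop :=
  IsInvolution k g σ₁ ∧ IsInvolution k g σ₂ ∧ ∀ x, σ₁ (σ₂ x) = σ₂ (σ₁ x)

/-- The subspace `g_{ij}` of the quaternionic decomposition determined by commuting
involutions `σ₁, σ₂`: here `i, j : Bool` and `false, true` encode the exponents `0, 1`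
of the eigenvalues `(-1)^i`, `(-1)^j`. -/
noncomputable def qSpace (σ₁ σ₂ : g ≃ₗ⁅k⁆ g) (i j : Bool) : Submodule k g :=
  eigSub k g σ₁ (if i then -1 else 1) ⊓ eigSub k g σ₂ (if j then -1 else 1)

/-- `x` is a semisimple element of `g`: `ad x` is a semisimple endomorphism. -/
def IsSSElt (x : g) : Prop := Module.End.IsSemisimple (ad k g x)

/-- `x` is a nilpotent element of `g`: `ad x` is a nilpotent endomorphism. -/
def IsNilpElt (x : g) : Prop := IsNilpotent (ad k g x)

/-- `x` is a regular element of `g`: the dimension of its centralizer equals the rank of `g`,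
i.e. the dimension of a Cartan subalgebra of `g`. -/
def IsRegElt (x : g) : Prop :=
  ∃ H : LieSubalgebra k g, H.IsCartanSubalgebra ∧
    Module.finrank k (LinearMap.ker (ad k g x)) = Module.finrank k H

/-- An involution is of maximal rank if its `(-1)`-eigenspace contains a Cartan
subalgebra of `g`. -/
def IsMaxRank (σ : g ≃ₗ⁅k⁆ g) : Prop :=
  ∃ H : LieSubalgebra k g, H.IsCartanSubalgebra ∧ H.toSubmodule ≤ eigSub k g σ (-1)

/-- The centralizer of an element `x`, as a Lie subalgebra of `g`. -/
def zg (x : g) : LieSubalgebra k g where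
  carrier := {y | ⁅x, y⁆ = 0}
  add_mem' := by
    intro a b ha hb
    simp only [Set.mem_setOf_eq] at *
    rw [lie_add, ha, hb, add_zero]
  zero_mem' := by simp
  smul_mem' := by
    intro t a ha
    simp only [Set.mem_setOf_eq] at *
    rw [lie_smul, ha, smul_zero]
  lie_mem' := by
    intro a b ha hb
    simp only [Set.mem_setOf_eq] at *
    rw [leibniz_lie, ha, hb, lie_zero, zero_lie, add_zero]

/-- The fixed-point subalgebra of a Lie algebra automorphism. -/
def fixSubalgebra (σ : g ≃ₗ⁅k⁆ g) : LieSubalgebra k g where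
  carrier := {x | σ x = x}
  add_mem' := by
    intro a b ha hb
    simp only [Set.mem_setOf_eq] at *
    rw [show σ (a + b) = σ a + σ b from σ.toLieHom.map_add a b, ha, hb]
  zero_mem' := by simp only [Set.mem_setOf_eq]; exact σ.toLieHom.map_zero
  smul_mem' := by
    intro t a ha
    simp only [Set.mem_setOf_eq] at *
    rw [show σ (t • a) = t • σ a from σ.toLieHom.map_smul t a, ha]
  lie_mem' := by
    intro a b ha hb
    simp only [Set.mem_setOf_eq] at *
    rw [LieEquiv.map_lie σ a b, ha, hb]

/-- The exponential of an endomorphism, as a finite sum (which is the genuine exponential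
when the endomorphism is nilpotent). -/
noncomputable def expEnd (f : Module.End k g) : Module.End k g :=
  ∑ i ∈ Finset.range (Module.finrank k g + 1), (i.factorial : k)⁻¹ • f ^ i

/-- An automorphism of `g` is inner if it lies in the subgroup of automorphisms generated
by the exponentials `exp (ad x)` with `ad x` nilpotent. -/
noncomputable def IsInnerAut (μ : g ≃ₗ⁅k⁆ g) : Prop :=
  μ.toLinearEquiv ∈ Subgroup.closure
    {e : g ≃ₗ[k] g | ∃ x : g, IsNilpotent (ad k g x) ∧
      (e : g →ₗ[k] g) = expEnd k g (ad k g x)}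

/-- `σ` and `τ` are conjugate by an inner automorphism of `g`. -/
noncomputable def InnerConj (σ τ : g ≃ₗ⁅k⁆ g) : Prop :=
  ∃ φ : g ≃ₗ⁅k⁆ g, IsInnerAut k g φ ∧ ∀ x, τ x = φ (σ (φ.symm x))

/-- A dyad: a pair of distinct commuting involutions that are conjugate by an inner
automorphism of `g`. -/
noncomputable def IsDyad (σ₁ σ₂ : g ≃ₗ⁅k⁆ g) : Prop :=
  IsInvolution k g σ₁ ∧ IsInvolution k g σ₂ ∧ σ₁ ≠ σ₂ ∧
    (∀ x, σ₁ (σ₂ x) = σ₂ (σ₁ x)) ∧ InnerConj k g σ₁ σ₂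

/-- The span of all brackets `⁅x, y⁆` with `x, y` in a subspace `m`. -/
noncomputable def bracketSpan (m : Submodule k g) : Submodule k g :=
  Submodule.span k {z | ∃ x ∈ m, ∃ y ∈ m, z = ⁅x, y⁆}

/-- `c` is a Cartan subspace of a subspace `m ⊆ g`: it consists of pairwise commuting
semisimple elements of `g` and is maximal among such subspaces of `m`. -/
def IsCartanSubspace (m c : Submodule k g) : Prop :=
  c ≤ m ∧ (∀ x ∈ c, IsSSElt k g x) ∧ (∀ x ∈ c, ∀ y ∈ c, ⁅x, y⁆ = 0) ∧
    ∀ c' : Submodule k g, c' ≤ m → (∀ x ∈ c', IsSSElt k g x) →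
      (∀ x ∈ c', ∀ y ∈ c', ⁅x, y⁆ = 0) → c ≤ c' → c' = c


section LinAlgB
open Polynomial

theorem aux_line_mat {K : Type*} [Field K] [Infinite K] {n ι : Type*} [Fintype n] [DecidableEq n]
    [Fintype ι] [DecidableEq ι] (A B : Matrix n n K) (P : ι → K[X]) (T : ι → Matrix n n K) (r : ℕ)
    (hA : Matrix.det (Matrix.of fun i j => Matrix.trace (aeval A (P i) * T j)) ≠ 0)
    (hB : B.charpoly.coeff r ≠ 0) :
    ∃ t : K, Matrix.det (Matrix.of fun i j => Matrix.trace (aeval (A + t • (B - A)) (P i) * T j)) ≠ 0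
      ∧ (A + t • (B - A)).charpoly.coeff r ≠ 0 := by
  classical
  let M : Matrix n n K[X] := A.map C + (X : K[X]) • (B - A).map C
  have hM : ∀ t : K, (aeval t : K[X] →ₐ[K] K).mapMatrix M = A + t • (B - A) := by
    intro t
    ext i j
    simp [M]
  let D : K[X] := Matrix.det (Matrix.of fun i j => Matrix.trace (aeval M (P i) * (T j).map C))
  have hD : ∀ t : K, D.eval t =
      Matrix.det (Matrix.of fun i j => Matrix.trace (aeval (A + t • (B - A)) (P i) * T j)) := by
    intro t
    have h1 : D.eval t = (aeval t : K[X] →ₐ[K] K) D := by simp [coe_aeval_eq_eval]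
    rw [h1]
    simp only [D]
    rw [AlgHom.map_det]
    congr 1
    ext i j
    simp only [AlgHom.mapMatrix_apply, Matrix.map_apply, Matrix.of_apply]
    refine (AddMonoidHom.map_trace ((aeval t : K[X] →ₐ[K] K) : K[X] →+ K) _).trans ?_
    congr 1
    have h2 := map_mul ((aeval t : K[X] →ₐ[K] K).mapMatrix (m := n)) (aeval M (P i)) ((T j).map C)
    rw [← aeval_algHom_apply, hM] at h2
    have h3 : (aeval t : K[X] →ₐ[K] K).mapMatrix ((T j).map C) = T j := by
      ext a b; simp
    rw [h3] at h2
    exact h2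
  let Q : K[X] := M.charpoly.coeff r
  have hQ : ∀ t : K, Q.eval t = (A + t • (B - A)).charpoly.coeff r := by
    intro t
    have := Matrix.charpoly_map M ((aeval t : K[X] →ₐ[K] K) : K[X] →+* K)
    have h4 : M.map ((aeval t : K[X] →ₐ[K] K) : K[X] →+* K) = A + t • (B - A) := by
      rw [← hM]; rfl
    rw [h4] at this
    rw [this, Polynomial.coeff_map]
    simp [Q]
  have hD0 : D ≠ 0 := by
    intro h
    have := hD 0
    rw [h] at this
    simp at this
    exact hA this.symm
  have hQ0 : Q ≠ 0 := by
    intro h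
    have := hQ 1
    rw [h] at this
    simp at this
    exact hB this.symm
  obtain ⟨t, ht⟩ := Polynomial.exists_eval_ne_zero_of_natDegree_lt_card (D * Q) (mul_ne_zero hD0 hQ0)
    (lt_of_lt_of_le (Cardinal.natCast_lt_aleph0) (Cardinal.aleph0_le_mk K))
  rw [eval_mul] at ht
  exact ⟨t, by rw [← hD]; exact left_ne_zero_of_mul ht, by rw [← hQ]; exact right_ne_zero_of_mul ht⟩

theorem aux_line {K V : Type*} [Field K] [Infinite K] [AddCommGroup V] [Module K V]
    [FiniteDimensional K V] {ι : Type*}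
    [Fintype ι] [DecidableEq ι] (A B : End K V) (P : ι → K[X]) (T : ι → End K V) (r : ℕ)
    (hA : Matrix.det (Matrix.of fun i j => LinearMap.trace K V (aeval A (P i) * T j)) ≠ 0)
    (hB : B.charpoly.coeff r ≠ 0) :
    ∃ t : K, Matrix.det (Matrix.of fun i j =>
        LinearMap.trace K V (aeval (A + t • (B - A)) (P i) * T j)) ≠ 0
      ∧ (A + t • (B - A)).charpoly.coeff r ≠ 0 := by
  classical
  let b := Module.finBasis K V
  let Φ := LinearMap.toMatrixAlgEquiv b
  have htr : ∀ (N : End K V) i j, LinearMap.trace K V (aeval N (P i) * T j) =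
      Matrix.trace (aeval (Φ N) (P i) * Φ (T j)) := by
    intro N i j
    rw [LinearMap.trace_eq_matrix_trace K b]
    congr 1
    have := map_mul Φ (aeval N (P i)) (T j)
    have h2 := aeval_algHom_apply Φ.toAlgHom N (P i)
    refine this.trans ?_
    congr 1
    exact h2.symm
  have hch : ∀ N : End K V, N.charpoly = (Φ N).charpoly := fun N =>
    (LinearMap.charpoly_toMatrix N b).symm
  simp only [htr, hch] at hA hB ⊢
  obtain ⟨t, h1, h2⟩ := aux_line_mat (Φ A) (Φ B) P (fun j => Φ (T j)) r hA hB
  exact ⟨t, by simpa using h1, by simpa using h2⟩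

end LinAlgB

section PartB
set_option linter.unusedSectionVars false
open Polynomial

variable {K L : Type*} [Field K] [IsAlgClosed K] [CharZero K] [LieRing L] [LieAlgebra K L]
  [FiniteDimensional K L] [LieAlgebra.IsKilling K L]

theorem partA (x : L) (hx : finrank K (LieSubalgebra.engel K x) ≤ LieAlgebra.rank K L) :
    (LieSubalgebra.engel K x).IsCartanSubalgebra := by
  have : Infinite K := inferInstance
  have h : (finrank K L : Cardinal) ≤ Cardinal.mk K :=
    (Cardinal.natCast_lt_aleph0).le.trans (Cardinal.aleph0_le_mk K)
  refine ⟨?_, LieSubalgebra.normalizer_engel _ _⟩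
  apply LieSubalgebra.isNilpotent_of_forall_le_engel
  intro y hy
  set Ex : {LieSubalgebra.engel K z | z ∈ LieSubalgebra.engel K x} :=
    ⟨LieSubalgebra.engel K x, x, LieSubalgebra.self_mem_engel _ _, rfl⟩
  suffices IsBot Ex from @this ⟨LieSubalgebra.engel K y, y, hy, rfl⟩
  apply LieAlgebra.engel_isBot_of_isMin h (LieSubalgebra.engel K x) Ex le_rfl
  rintro ⟨_, y, hy, rfl⟩ hyx
  suffices finrank K (LieSubalgebra.engel K x) ≤ finrank K (LieSubalgebra.engel K y) by
    suffices LieSubalgebra.engel K y = LieSubalgebra.engel K x from this.ge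
    apply LieSubalgebra.toSubmodule_injective
    exact Submodule.eq_of_le_of_finrank_le hyx this
  exact hx.trans (rank_le_finrank_engel K y)

/-- induction over the root decomposition -/
theorem weight_ext (H : LieSubalgebra K L) [H.IsCartanSubalgebra] {f f' : End K L}
    (h : ∀ (χ : LieModule.Weight K H L) (v : L), v ∈ rootSpace H χ → f v = f' v) : f = f' := by
  ext v
  have hv : v ∈ (⨆ χ : LieModule.Weight K H L, LieModule.genWeightSpace L (χ : H → K)) := by
    rw [LieModule.iSup_genWeightSpace_eq_top' K H L]; trivial
  induction hv using LieSubmodule.iSup_induction' with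
  | mem i x hx => exact h i x hx
  | zero => simp
  | add x y _ _ hx hy => simp [hx, hy]

theorem exists_sep (H : LieSubalgebra K L) [H.IsCartanSubalgebra] :
    ∃ h : H, Function.Injective (fun χ : LieModule.Weight K H L => χ h) := by
  classical
  let I := {p : LieModule.Weight K H L × LieModule.Weight K H L // p.1 ≠ p.2}
  obtain ⟨h, hh⟩ := Module.Dual.exists_forall_ne_zero_of_forall_exists
    (fun p : I => (p.1.1.toLinear - p.1.2.toLinear : Dual K H)) (by
      rintro ⟨⟨a, b⟩, hab⟩
      by_contra! h0
      apply hab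
      ext x
      have := h0 x
      simpa [sub_eq_zero] using this)
  refine ⟨h, fun a b hab => ?_⟩
  by_contra hne
  apply hh ⟨(a, b), hne⟩
  simpa [sub_eq_zero] using hab

theorem exists_poly (H : LieSubalgebra K L) [H.IsCartanSubalgebra] (h : H)
    (hh : Function.Injective (fun χ : LieModule.Weight K H L => χ h)) (w : H) :
    ∃ P : K[X], aeval (ad K L h) P = ad K L w := by
  classical
  refine ⟨Lagrange.interpolate Finset.univ (fun χ : LieModule.Weight K H L => χ h) (fun χ => χ w), ?_⟩
  apply weight_ext H
  intro χ v hv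
  have h1 : ad K L h v = χ h • v := by
    have := IsKilling.lie_eq_smul_of_mem_rootSpace hv h
    simpa using this
  have h2 : ad K L w v = χ w • v := by
    have := IsKilling.lie_eq_smul_of_mem_rootSpace hv w
    simpa using this
  rw [Module.End.aeval_apply_of_mem_apply_eq_smul h1, h2]
  congr 1
  exact Lagrange.eval_interpolate_at_node _ hh.injOn (Finset.mem_univ χ)

theorem partB (H : LieSubalgebra K L) [H.IsCartanSubalgebra] :
    finrank K H ≤ LieAlgebra.rank K L := by
  classical
  have : Infinite K := inferInstance
  obtain ⟨h, hh⟩ := exists_sep H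
  let w := Module.finBasis K H
  choose P hP using fun i => exists_poly H h hh (w i)
  obtain ⟨y, hy⟩ := LieAlgebra.exists_isRegular K L
  have hgram : Matrix.det (Matrix.of fun i j =>
      LinearMap.trace K L (aeval (ad K L h) (P i) * ad K L (w j))) ≠ 0 := by
    have h1 := LieAlgebra.IsKilling.traceForm_cartan_nondegenerate K L H
    have h2 := (LinearMap.BilinForm.nondegenerate_iff_det_ne_zero w).mp h1
    convert h2 using 2
    simp only [hP]
    refine Matrix.ext fun i j => ?_
    rw [LinearMap.BilinForm.toMatrix_apply]
    rfl
  obtain ⟨t, ht1, ht2⟩ := aux_line (ad K L h) (ad K L y) P (fun j => ad K L (w j))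
    (LieAlgebra.rank K L) hgram (by
      exact (LieAlgebra.isRegular_def K y).mp hy)
  set z : L := (h : L) + t • (y - h) with hz
  have hzad : ad K L h + t • (ad K L y - ad K L h) = ad K L z := by simp [hz]
  rw [hzad] at ht1 ht2
  have hE : finrank K (LieSubalgebra.engel K z) ≤ LieAlgebra.rank K L := by
    rw [finrank_engel]
    exact Polynomial.natTrailingDegree_le_of_ne_zero ht2
  refine le_trans ?_ hE
  have hker : LinearMap.ker (ad K L z) ≤ (LieSubalgebra.engel K z).toSubmodule := by
    intro v hv
    change v ∈ LieSubalgebra.engel K z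
    rw [LieSubalgebra.mem_engel_iff]
    exact ⟨1, by simpa using hv⟩
  refine le_trans ?_ (Submodule.finrank_mono hker)
  -- functional map
  let T : L →ₗ[K] (Fin (finrank K H) → K) :=
    LinearMap.pi fun i => (LinearMap.trace K L ∘ₗ LinearMap.mulLeft K (aeval (ad K L z) (P i))) ∘ₗ
      (ad K L : L →ₗ[K] End K L)
  have hT : ∀ i v, T v i = LinearMap.trace K L (aeval (ad K L z) (P i) * ad K L v) := fun i v => rfl
  have hsurj : LinearMap.range T = ⊤ := by
    have hli : LinearIndependent K (fun j => T (w j)) := by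
      have := Matrix.linearIndependent_cols_of_det_ne_zero ht1
      exact this
    have := hli.span_eq_top_of_card_eq_finrank' (by simp)
    rw [eq_top_iff, ← this, Submodule.span_le]
    rintro _ ⟨j, rfl⟩
    exact ⟨_, rfl⟩
  have hkill : LinearMap.range (ad K L z) ≤ LinearMap.ker T := by
    rintro _ ⟨v, rfl⟩
    rw [LinearMap.mem_ker]
    ext i
    rw [hT]
    have hcomm : Commute (aeval (ad K L z) (P i)) (ad K L z) :=
      by
        have e1 := map_mul (aeval (ad K L z)) (P i) X
        have e2 := map_mul (aeval (ad K L z)) X (P i)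
        rw [aeval_X] at e1 e2
        rw [commute_iff_eq, ← e1, ← e2, mul_comm]
    have e3 : ad K L (ad K L z v) = ad K L z * ad K L v - ad K L v * ad K L z := by
      ext u; simp only [ad_apply, LinearMap.sub_apply, Module.End.mul_apply, lie_lie]
    rw [e3, mul_sub, map_sub, ← mul_assoc, ← mul_assoc, hcomm.eq, mul_assoc (ad K L z),
      LinearMap.trace_mul_comm K (ad K L z)]
    simp
  have e1 := LinearMap.finrank_range_add_finrank_ker T
  have e2 := LinearMap.finrank_range_add_finrank_ker (ad K L z)
  have e3 := Submodule.finrank_mono hkill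
  rw [hsurj, finrank_top] at e1
  simp at e1
  omega

end PartB

section LinAlg
variable {K : Type*} [Field K] [CharZero K] {V : Type*} [AddCommGroup V] [Module K V]

lemma aux_pow_shift (E H : End K V) (hHE : H * E - E * H = (2 : K) • E) (n : ℕ) :
    H * E ^ n = E ^ n * H + (2 * n : K) • E ^ n := by
  have h1 : H * E = E * H + (2 : K) • E := by rw [← hHE]; abel
  induction n with
  | zero => simp
  | succ n ih =>
    rw [pow_succ, ← mul_assoc, ih, add_mul, mul_assoc, h1]
    simp only [mul_add, mul_smul_comm, smul_mul_assoc, ← mul_assoc, ← pow_succ]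
    push_cast
    module

lemma aux_FE (E F H : End K V) (hEF : E * F - F * E = H) (hHE : H * E - E * H = (2 : K) • E)
    (n : ℕ) :
    F * E ^ n = E ^ n * F - (n : K) • (E ^ (n - 1) * H) - (n * (n - 1) : K) • E ^ (n - 1) := by
  have h1 : F * E = E * F - H := by rw [← hEF]; abel
  induction n with
  | zero => simp
  | succ n ih =>
    rw [pow_succ, ← mul_assoc, ih]
    have h2 : H * E = E * H + (2 : K) • E := by rw [← hHE]; abel
    rcases n with _ | n
    · simp [h1]
    · simp only [Nat.add_sub_cancel, sub_mul, smul_mul_assoc, mul_assoc, h1, h2, mul_sub, mul_add,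
        mul_smul_comm, pow_succ]
      push_cast
      module

/-- Eigenvalues of `H` on `ker E` are natural numbers. -/
lemma aux_eig_nat (E F H : End K V) (hEF : E * F - F * E = H)
    (hHE : H * E - E * H = (2 : K) • E) (hE : IsNilpotent E) (v : V) (hv : v ≠ 0)
    (hEv : E v = 0) (μ : K) (hμ : H v = μ • v) : ∃ n : ℕ, μ = n := by
  obtain ⟨N, hN⟩ := hE
  have hex : ∃ i, ¬ ∃ y, (E ^ i) y = v := ⟨N, by rintro ⟨y, hy⟩; simp [hN] at hy; exact hv hy.symm⟩
  classical
  obtain ⟨i, hi⟩ : ∃ i, Nat.find hex = i + 1 := by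
    refine Nat.exists_eq_succ_of_ne_zero ?_
    intro h0
    exact (Nat.find_eq_zero hex).1 h0 ⟨v, by simp⟩
  have h1 : ¬ ∃ y, (E ^ (i+1)) y = v := hi ▸ Nat.find_spec hex
  have h2 : ∃ y, (E ^ i) y = v := by
    have := Nat.find_min hex (m := i) (by omega)
    simpa using this
  obtain ⟨y, hy⟩ := h2
  refine ⟨i, ?_⟩
  have key : ((1 + i) * (μ - i) : K) • v = (E ^ (i+1)) (F y) := by
    have e1 : H v = E (F v) := by
      have := congrArg (fun T : End K V => T v) hEF
      simp [hEv] at this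
      exact this.symm
    have e2 : F v = (E^i) (F y) - (i : K) • ((E ^ (i-1)) (H y)) - (i * (i-1) : K) • ((E^(i-1)) y) := by
      have := congrArg (fun T : End K V => T y) (aux_FE E F H hEF hHE i)
      simpa [hy] using this
    have e3 : H v = (E ^ i) (H y) + (2 * i : K) • v := by
      have := congrArg (fun T : End K V => T y) (aux_pow_shift E H hHE i)
      simpa [hy] using this
    have e4 : E (F v) = (E ^ (i+1)) (F y) - (i : K) • ((E ^ i) (H y)) - (i * (i-1) : K) • v := by
      rw [e2]
      rcases i with _ | i
      · simp
      · simp only [map_sub, map_smul, Nat.add_sub_cancel, ← Module.End.mul_apply, ← mul_assoc,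
          ← pow_succ']
        rw [← hy]
    have e5 : (E ^ i) (H y) = μ • v - (2 * i : K) • v := by rw [← hμ, e3]; abel
    have e6 : (E ^ (i+1)) (F y) = H v + (i : K) • ((E ^ i) (H y)) + (i * (i-1) : K) • v := by
      rw [e1, e4]; abel
    rw [e6, e5, hμ]
    module
  by_contra hne
  apply h1
  have hc : ((1 + i) * (μ - i) : K) ≠ 0 := by
    refine mul_ne_zero ?_ (sub_ne_zero.2 hne)
    exact_mod_cast (by omega : 1 + i ≠ 0)
  refine ⟨((1 + i) * (μ - i) : K)⁻¹ • F y, ?_⟩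
  rw [map_smul, ← key, smul_smul, inv_mul_cancel₀ hc, one_smul]

/-- `F` with `[H, F] = c F`, `c ≠ 0`, is nilpotent. -/
lemma aux_nilp [FiniteDimensional K V] (F H : End K V) (c : K) (hc : c ≠ 0)
    (hHF : H * F - F * H = c • F) : IsNilpotent F := by
  by_contra hF
  let A : End K (End K V) := LinearMap.mulLeft K H - LinearMap.mulRight K H
  have hA : ∀ n : ℕ, A (F ^ n) = (c * n) • F ^ n := by
    intro n
    have h1 : H * F = F * H + c • F := by rw [← hHF]; abel
    simp only [A, LinearMap.sub_apply, LinearMap.mulLeft_apply, LinearMap.mulRight_apply]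
    induction n with
    | zero => simp
    | succ n ih =>
      have ih' : H * F ^ n = F ^ n * H + (c * n) • F ^ n := by rw [← ih]; abel
      rw [pow_succ, ← mul_assoc, ih', add_mul, mul_assoc, h1]
      simp only [mul_add, mul_smul_comm, smul_mul_assoc, ← mul_assoc, ← pow_succ]
      push_cast
      module
  have hev : ∀ n : ℕ, A.HasEigenvalue (c * n) := fun n =>
    Module.End.hasEigenvalue_of_hasEigenvector (x := F ^ n)
      ⟨Module.End.mem_eigenspace_iff.2 (hA n), fun h => hF ⟨n, h⟩⟩
  have hfin : Set.Finite {μ | A.HasEigenvalue μ} := Module.End.finite_hasEigenvalue A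
  have hinj : Function.Injective (fun n : ℕ => c * (n : K)) := by
    intro a b h
    have := mul_left_cancel₀ hc h
    exact_mod_cast this
  exact Set.infinite_range_of_injective hinj (hfin.subset (by rintro _ ⟨n, rfl⟩; exact hev n))

/-- If `[E, [E, Z]] = 0` with `E` nilpotent then `[E, Z]` is nilpotent. -/
lemma aux_comm_nilp (E Z : End K V) (hE : IsNilpotent E)
    (h : Commute E (E * Z - Z * E)) : IsNilpotent (E * Z - Z * E) := by
  set C := E * Z - Z * E with hC
  let D : End K (End K V) := LinearMap.mulLeft K E - LinearMap.mulRight K E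
  have hD : ∀ X, D X = E * X - X * E := fun X => rfl
  have hDn : IsNilpotent D := by
    refine Commute.isNilpotent_sub ?_ ?_ ?_
    · apply LinearMap.commute_mulLeft_right
    · exact (LinearMap.isNilpotent_mulLeft_iff K E).2 hE
    · exact (LinearMap.isNilpotent_mulRight_iff K E).2 hE
  have hDZ : ∀ (n : ℕ) (W : End K V), (D ^ (n+1)) (Z * W) =
      Z * (D ^ (n+1)) W + ((n + 1 : ℕ) : K) • (C * (D ^ n) W) := by
    have hD1 : ∀ X Y, D (X * Y) = D X * Y + X * D Y := by
      intro X Y; simp only [hD]; noncomm_ring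
    have hDC : D C = 0 := by rw [hD, h.eq, sub_self]
    have hDZ' : D Z = C := rfl
    intro n W
    induction n with
    | zero => simp [hD1, hDZ', add_comm]
    | succ n ih =>
      rw [pow_succ', Module.End.mul_apply, ih, map_add, map_smul, hD1, hD1, hDC, hDZ']
      rw [← Module.End.mul_apply D (D ^ (n+1)), ← pow_succ', ← Module.End.mul_apply D (D ^ n),
        ← pow_succ']
      push_cast
      simp only [zero_mul, zero_add]
      module
  have hDpow : ∀ n : ℕ, (D ^ n) (Z ^ n) = (n.factorial : K) • C ^ n := by
    intro n
    induction n with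
    | zero => simp
    | succ n ih =>
      have h0 : (D ^ (n+1)) (Z ^ n) = 0 := by
        rw [pow_succ', Module.End.mul_apply, ih, map_smul, hD, (h.pow_right n).eq, sub_self, smul_zero]
      rw [pow_succ' Z, hDZ, h0, ih, Nat.factorial_succ, pow_succ' C]
      push_cast
      simp only [mul_zero, zero_add, mul_smul_comm, smul_smul]
  obtain ⟨N, hN⟩ := hDn
  refine ⟨N, ?_⟩
  have := hDpow N
  rw [hN, LinearMap.zero_apply] at this
  exact (smul_eq_zero.1 this.symm).resolve_left (by exact_mod_cast Nat.factorial_ne_zero N)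

lemma aux_EZ_nilp (E Z : End K V) (hE : IsNilpotent E)
    (h : Commute E (E * Z - Z * E)) : IsNilpotent (E * Z) := by
  obtain ⟨N, hN⟩ := aux_comm_nilp E Z hE h
  set C := E * Z - Z * E with hC
  have hpow : ∀ n : ℕ, E ^ (n+1) * Z = Z * E ^ (n+1) + ((n + 1 : ℕ) : K) • (C * E ^ n) := by
    intro n
    have h1 : E * Z = Z * E + C := by rw [hC]; abel
    induction n with
    | zero => simp [h1]
    | succ n ih =>
      rw [pow_succ' E (n+1), mul_assoc, ih, mul_add, ← mul_assoc, h1, mul_smul_comm, ← mul_assoc, h.eq,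
        mul_assoc C, ← pow_succ', add_mul, mul_assoc Z, ← pow_succ']
      push_cast
      module
  have step : ∀ (n : ℕ) (v : V), (E ^ (n+1)) v = 0 →
      (E ^ n) ((E * Z) v) = ((n + 1 : ℕ) : K) • C ((E ^ n) v) := by
    intro n v hv
    have := congrArg (fun T : End K V => T v) (hpow n)
    simp only [Module.End.mul_apply, LinearMap.add_apply, LinearMap.smul_apply, hv, map_zero,
      zero_add] at this
    rw [← this, pow_succ]; rfl
  have stab : ∀ (n : ℕ) (v : V), (E ^ n) v = 0 → (E ^ n) ((E * Z) v) = 0 := by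
    intro n v hv
    rw [step n v (by rw [pow_succ', Module.End.mul_apply, hv, map_zero]), hv]; simp
  have step2 : ∀ (n j : ℕ) (v : V), (E ^ (n+1)) v = 0 → (E ^ (n+1)) (((E * Z) ^ j) v) = 0 ∧
      (E ^ n) (((E * Z) ^ j) v) = (((n + 1 : ℕ) : K) ^ j) • (C ^ j) ((E ^ n) v) := by
    intro n j v hv
    induction j with
    | zero => simp [hv]
    | succ j ih =>
      rw [pow_succ' (E * Z), Module.End.mul_apply]
      refine ⟨stab _ _ ih.1, ?_⟩
      rw [step n _ ih.1, ih.2, map_smul, pow_succ' C, Module.End.mul_apply, smul_smul, pow_succ']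
  have fin : ∀ n : ℕ, ∀ v, (E ^ n) v = 0 → ((E * Z) ^ (N * n)) v = 0 := by
    intro n
    induction n with
    | zero => intro v hv; simpa using hv
    | succ n ih =>
      intro v hv
      rw [mul_add, mul_one, pow_add, Module.End.mul_apply]
      apply ih
      rw [(step2 n N v hv).2, hN]; simp
  obtain ⟨M, hM⟩ := hE
  exact ⟨N * M, LinearMap.ext fun v => fin M v (by simp [hM])⟩

end LinAlg

section PartC
set_option linter.unusedSectionVars false

variable {K : Type*} [Field K] [CharZero K] {V : Type*} [AddCommGroup V] [Module K V]
  [FiniteDimensional K V]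

theorem map_biSup_le (G : K → Submodule K V) (E : End K V)
    (hE : ∀ μ v, v ∈ G μ → E v ∈ G (μ + 2)) (s t : Set K) (hst : ∀ μ ∈ s, μ + 2 ∈ t) :
    (⨆ μ ∈ s, G μ) ≤ (⨆ μ ∈ t, G μ).comap E := by
  refine iSup₂_le fun μ hμ v hv => ?_
  exact (le_iSup₂_of_le (f := fun μ (_ : μ ∈ t) => G μ) (μ + 2) (hst μ hμ) le_rfl) (hE μ v hv)

theorem evens_split (G : K → Submodule K V) :
    (⨆ μ ∈ Set.range (fun n : ℕ => (2 * n : K)), G μ) =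
      G 0 ⊔ (⨆ μ ∈ Set.range (fun n : ℕ => (2 * (n + 1) : K)), G μ) := by
  apply le_antisymm
  · refine iSup₂_le ?_
    rintro _ ⟨n, rfl⟩
    cases n with
    | zero => simp
    | succ n =>
      refine le_sup_of_le_right ?_
      exact le_iSup₂_of_le (f := fun μ (_ : μ ∈ _) => G μ) _ ⟨n, rfl⟩ (by push_cast; exact le_rfl)
  · refine sup_le ?_ ?_
    · exact le_iSup₂_of_le (f := fun μ (_ : μ ∈ _) => G μ) _ ⟨0, rfl⟩ (by simp)
    · refine iSup₂_le ?_
      rintro _ ⟨n, rfl⟩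
      exact le_iSup₂_of_le (f := fun μ (_ : μ ∈ _) => G μ) _ ⟨n + 1, rfl⟩ (by push_cast; exact le_rfl)

theorem two_mul_succ_ne_zero (n : ℕ) : (2 * ((n : K) + 1)) ≠ 0 := by
  have : ((n : K) + 1) ≠ 0 := Nat.cast_add_one_ne_zero n
  simpa using this

theorem partC (E H : End K V) (hHE : H * E - E * H = (2 : K) • E) :
    finrank K (H.maxGenEigenspace 0) ≤ finrank K (LinearMap.ker E) := by
  have hE : ∀ μ v, v ∈ H.maxGenEigenspace μ → E v ∈ H.maxGenEigenspace (μ + 2) := by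
    intro μ v hv
    rw [Module.End.mem_maxGenEigenspace] at hv ⊢
    obtain ⟨n, hn⟩ := hv
    refine ⟨n, ?_⟩
    have hs : SemiconjBy E (H - μ • 1) (H - (μ + 2) • 1) := by
      unfold SemiconjBy
      have : H * E = E * H + (2 : K) • E := by rw [← hHE]; abel
      rw [mul_sub, sub_mul, this]
      simp only [mul_smul_comm, smul_mul_assoc, mul_one, one_mul]
      module
    have := congrArg (fun T : End K V => T v) (hs.pow_right n).eq
    simp only [Module.End.mul_apply] at this
    rw [← this, hn, map_zero]
  set W := ⨆ μ ∈ Set.range (fun n : ℕ => (2 * n : K)), H.maxGenEigenspace μ with hW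
  set W' := ⨆ μ ∈ Set.range (fun n : ℕ => (2 * (n + 1) : K)), H.maxGenEigenspace μ with hW'
  have hsplit : W = H.maxGenEigenspace 0 ⊔ W' := evens_split _
  have hdisj : Disjoint (H.maxGenEigenspace 0) W' := by
    refine (Module.End.independent_maxGenEigenspace H).disjoint_biSup (x := 0) ?_
    rintro ⟨n, hn⟩
    exact two_mul_succ_ne_zero n hn
  have hmap : W ≤ W'.comap E := by
    apply map_biSup_le _ E hE
    rintro _ ⟨n, rfl⟩
    exact ⟨n, by ring⟩
  have d1 : finrank K W = finrank K (H.maxGenEigenspace 0) + finrank K W' := by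
    have := Submodule.finrank_sup_add_finrank_inf_eq (H.maxGenEigenspace 0) W'
    rw [hdisj.eq_bot, finrank_bot, ← hsplit] at this
    simpa using this
  have d2 := LinearMap.finrank_range_add_finrank_ker (E.domRestrict W)
  have d3 : finrank K (LinearMap.range (E.domRestrict W)) ≤ finrank K W' := by
    apply Submodule.finrank_mono
    rintro _ ⟨w, rfl⟩
    exact hmap w.2
  have d4 : finrank K (LinearMap.ker (E.domRestrict W)) ≤ finrank K (LinearMap.ker E) := by
    refine LinearMap.finrank_le_finrank_of_injective
      (f := (W.subtype.restrict (p := LinearMap.ker (E.domRestrict W)) (q := LinearMap.ker E) ?_)) ?_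
    · intro x hx; simpa using hx
    · intro a b hab
      apply Subtype.ext; apply Subtype.ext
      exact congrArg (fun q : LinearMap.ker E => (q : V)) hab
  omega

/-- If `κ` is nondegenerate symmetric and `D` is (skew) self-adjoint, `range D = (ker D)^⊥`. -/
theorem mem_range_of_orth (B : LinearMap.BilinForm K V) (hB : B.Nondegenerate) (hs : B.IsSymm)
    (D : End K V) (ε : K) (hε : ε ≠ 0) (hD : ∀ u v, B (D u) v = ε * B u (D v)) (v : V)
    (hv : ∀ z, D z = 0 → B v z = 0) : v ∈ LinearMap.range D := by
  rw [← LinearMap.BilinForm.orthogonal_orthogonal hB hs.isRefl (LinearMap.range D)]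
  rw [LinearMap.BilinForm.mem_orthogonal_iff]
  intro z hz
  rw [LinearMap.BilinForm.mem_orthogonal_iff] at hz
  have : D z = 0 := by
    apply hB.2
    intro u
    have h1 := hz (D u) ⟨u, rfl⟩
    change B (D u) z = 0 at h1
    rw [hD] at h1
    simpa [hε] using h1
  have h2 := hv z this
  change B z v = 0
  rw [← h2]
  exact (hs.eq z v)

theorem partC' (B : LinearMap.BilinForm K V) (hB : B.Nondegenerate) (hs : B.IsSymm)
    (E F H : End K V) (hEF : E * F - F * E = H) (hHE : H * E - E * H = (2 : K) • E)
    (hE : IsNilpotent E)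
    (hBE : ∀ u v, B (E u) v = -1 * B u (E v))
    (hBH : ∀ u v, B (H u) v = -1 * B u (H v))
    (htop : (⨆ μ ∈ Set.range (fun m : ℤ => (2 * m : K)), H.eigenspace μ) = ⊤) :
    finrank K (LinearMap.ker E) ≤ finrank K (LinearMap.ker H) := by
  have hHE' : H * E = E * H + (2 : K) • E := by rw [← hHE]; abel
  have hHEv : ∀ v, H (E v) = E (H v) + (2 : K) • E v := fun v => by
    have := congrArg (fun T : End K V => T v) hHE'
    simpa using this
  have hind := Module.End.eigenspaces_iSupIndep H
  have hEG : ∀ μ v, v ∈ H.eigenspace μ → E v ∈ H.eigenspace (μ + 2) := by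
    intro μ v hv
    rw [Module.End.mem_eigenspace_iff] at hv ⊢
    rw [hHEv, hv, map_smul, add_smul]
  set W := ⨆ μ ∈ Set.range (fun n : ℕ => (2 * n : K)), H.eigenspace μ with hW
  set W' := ⨆ μ ∈ Set.range (fun n : ℕ => (2 * (n + 1) : K)), H.eigenspace μ with hW'
  set N := ⨆ μ ∈ Set.range (fun n : ℕ => (-2 * (n + 1) : K)), H.eigenspace μ with hN
  set N' := ⨆ μ ∈ Set.range (fun n : ℕ => (-2 * n : K)), H.eigenspace μ with hN'
  have hsplit : W = H.eigenspace 0 ⊔ W' := evens_split _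
  have hker0 : H.eigenspace 0 = LinearMap.ker H := Module.End.eigenspace_zero H
  -- kernel
  have hkerE : LinearMap.ker E ≤ W := by
    have htop' : (⨆ μ, H.eigenspace μ) = ⊤ := by
      rw [eq_top_iff, ← htop]
      exact iSup₂_le fun μ _ => le_iSup (fun μ => H.eigenspace μ) μ
    have h1 := Submodule.inf_iSup_genEigenspace (p := LinearMap.ker E) (f := H) (k := 1) (by
      intro v hv
      rw [LinearMap.mem_ker] at hv ⊢
      have := hHEv v
      rw [hv] at this
      simpa using this.symm)
    have h2 : (⨆ μ, H.genEigenspace μ 1) = ⊤ := htop'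
    rw [h2, inf_top_eq] at h1
    rw [h1]
    refine iSup_le fun μ => ?_
    rintro v ⟨hv1, hv2⟩
    by_cases hv0 : v = 0
    · rw [hv0]; exact zero_mem _
    have hv3 : H v = μ • v := Module.End.mem_eigenspace_iff.mp hv2
    obtain ⟨n, rfl⟩ := aux_eig_nat E F H hEF hHE hE v hv0 hv1 μ hv3
    by_cases hmem : (n : K) ∈ Set.range (fun m : ℤ => (2 * m : K))
    · obtain ⟨m, hm⟩ := hmem
      simp only at hm
      have hm' : 2 * m = (n : ℤ) := by exact_mod_cast hm
      obtain ⟨q, rfl⟩ : ∃ q : ℕ, n = 2 * q := ⟨m.toNat, by omega⟩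
      refine (le_iSup₂_of_le (f := fun μ (_ : μ ∈ Set.range (fun n : ℕ => (2 * n : K))) => H.eigenspace μ)
        _ ⟨q, rfl⟩ le_rfl) ?_
      push_cast at hv2
      exact hv2
    · have := hind.disjoint_biSup hmem
      rw [htop] at this
      exact absurd (by simpa using (this.le_bot ⟨hv2, trivial⟩)) hv0
  -- range
  have horth : ∀ a b u v, u ∈ H.eigenspace a → v ∈ H.eigenspace b → a + b ≠ 0 → B u v = 0 := by
    intro a b u v hu hv hab
    rw [Module.End.mem_eigenspace_iff] at hu hv
    have := hBH u v
    rw [hu, hv] at this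
    simp at this
    have h2 : (a + b) * B u v = 0 := by linear_combination this
    exact (mul_eq_zero.mp h2).resolve_left hab
  have hWW : ∀ u ∈ W', ∀ z ∈ W, B u z = 0 := by
    intro u hu z hz
    have hle : W' ≤ LinearMap.ker (B.flip z) := by
      refine iSup₂_le ?_
      rintro _ ⟨n, rfl⟩ u hu
      have hle2 : W ≤ LinearMap.ker (B u) := by
        refine iSup₂_le ?_
        rintro _ ⟨m, rfl⟩ z hz
        refine horth _ _ _ _ hu hz ?_
        have := two_mul_succ_ne_zero (K := K) (n + m)
        intro h; apply this; push_cast; linear_combination h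
      exact hle2 hz
    exact hle hu
  have hrange : W' ≤ LinearMap.range E := by
    intro v hv
    exact mem_range_of_orth B hB hs E (-1) (by simp) hBE v (fun z hz => hWW v hv z (hkerE hz))
  have hdisj : Disjoint W' N' := by
    refine hind.disjoint_biSup_biSup ?_
    rw [Set.disjoint_left]
    rintro _ ⟨n, rfl⟩ ⟨m, hm⟩
    have := two_mul_succ_ne_zero (K := K) (n + m)
    simp only at hm
    apply this; push_cast; linear_combination -hm
  have hU : W'.comap E ≤ W := by
    intro u hu
    have hu' : u ∈ W ⊔ N := by
      have : (⊤ : Submodule K V) ≤ W ⊔ N := by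
        rw [← htop]
        refine iSup₂_le ?_
        rintro _ ⟨m, rfl⟩
        rcases le_or_gt 0 m with hm | hm
        · obtain ⟨q, rfl⟩ := Int.eq_ofNat_of_zero_le hm
          refine le_sup_of_le_left ?_
          exact le_iSup₂_of_le (f := fun μ (_ : μ ∈ _) => H.eigenspace μ) _ ⟨q, rfl⟩ (by simp)
        · obtain ⟨q, hq⟩ : ∃ q : ℕ, m = -(q + 1 : ℤ) := ⟨(-m - 1).toNat, by omega⟩
          subst hq
          refine le_sup_of_le_right ?_
          refine le_iSup₂_of_le (f := fun μ (_ : μ ∈ _) => H.eigenspace μ) _ ⟨q, rfl⟩ (le_of_eq ?_)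
          congr 1
          push_cast; ring
      exact this trivial
    obtain ⟨w, hw, n, hn, rfl⟩ := Submodule.mem_sup.mp hu'
    have hEw : E w ∈ W' := by
      refine map_biSup_le _ E hEG _ _ ?_ hw
      rintro _ ⟨n, rfl⟩
      exact ⟨n, by ring⟩
    have hEn : E n ∈ N' := by
      refine map_biSup_le _ E hEG _ _ ?_ hn
      rintro _ ⟨n, rfl⟩
      exact ⟨n, by ring⟩
    have hEn' : E n ∈ W' := by
      have h3 : E (w + n) ∈ W' := hu
      rw [map_add] at h3
      exact (Submodule.add_mem_iff_right _ hEw).mp h3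
    have hEn0 : E n = 0 := by
      simpa using hdisj.le_bot ⟨hEn', hEn⟩
    exact add_mem hw (hkerE hEn0)
  have hU' : finrank K (LinearMap.ker E) + finrank K W' ≤ finrank K W := by
    have d2 := LinearMap.finrank_range_add_finrank_ker (E.domRestrict W)
    have d3 : finrank K W' ≤ finrank K (LinearMap.range (E.domRestrict W)) := by
      apply Submodule.finrank_mono
      intro v hv
      obtain ⟨u, rfl⟩ := hrange hv
      exact ⟨⟨u, hU hv⟩, rfl⟩
    have d4 : finrank K (LinearMap.ker E) ≤ finrank K (LinearMap.ker (E.domRestrict W)) := by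
      let φ : LinearMap.ker E →ₗ[K] LinearMap.ker (E.domRestrict W) :=
        LinearMap.codRestrict _ (Submodule.inclusion hkerE) (fun c => by
          rw [LinearMap.mem_ker]; exact c.2)
      refine LinearMap.finrank_le_finrank_of_injective (f := φ) ?_
      intro a b hab
      apply Subtype.ext
      exact congrArg (fun q : LinearMap.ker (E.domRestrict W) => ((q : W) : V)) hab
    omega
  have d5 := Submodule.finrank_add_le_finrank_add_finrank (H.eigenspace 0) W'
  rw [← hsplit, hker0] at d5
  omega

end PartC

section PartE
set_option linter.unusedSectionVars false

variable {K L : Type*} [Field K] [IsAlgClosed K] [CharZero K] [LieRing L] [LieAlgebra K L]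
  [FiniteDimensional K L] [LieAlgebra.IsKilling K L]

theorem kill_skew (e u v : L) :
    killingForm K L (ad K L e u) v = -1 * killingForm K L u (ad K L e v) := by
  have := LieModule.traceForm_apply_lie_apply K L L u e v
  rw [ad_apply, ad_apply, ← lie_skew e u, map_neg, LinearMap.neg_apply]
  rw [neg_one_mul, neg_inj]
  exact this

theorem ad_lie_eq (x y : L) : ad K L ⁅x, y⁆ = ad K L x * ad K L y - ad K L y * ad K L x := by
  ext u; simp only [ad_apply, LinearMap.sub_apply, Module.End.mul_apply, lie_lie]

theorem kill_nondeg : (killingForm K L).Nondegenerate := LieAlgebra.IsKilling.killingForm_nondegenerate K L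

theorem kill_symm : (killingForm K L).IsSymm :=
  ⟨fun x y => LieModule.traceForm_comm K L L x y⟩

theorem gradedJM (σ : L ≃ₗ⁅K⁆ L) (hσ : ∀ x, σ (σ x) = x) (e : L) (he : σ e = -e)
    (hnil : IsNilpotent (ad K L e)) :
    ∃ f h : L, σ f = -f ∧ ⁅e, f⁆ = h ∧ ⁅h, e⁆ = (2 : K) • e ∧ ⁅h, f⁆ = (-2 : K) • f := by
  have h1 : e ∈ LinearMap.range (ad K L e * ad K L e) := by
    refine mem_range_of_orth (killingForm K L) kill_nondeg kill_symm _ 1 one_ne_zero ?_ e ?_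
    · intro u v
      rw [Module.End.mul_apply, kill_skew, kill_skew, Module.End.mul_apply]; ring
    · intro z hz
      have hz' : ⁅e, ⁅e, z⁆⁆ = 0 := by simpa using hz
      have hc : Commute (ad K L e) (ad K L e * ad K L z - ad K L z * ad K L e) := by
        rw [← ad_lie_eq, commute_iff_eq, ← sub_eq_zero, ← ad_lie_eq, hz', map_zero]
      have := aux_EZ_nilp _ _ hnil hc
      have := (LinearMap.isNilpotent_trace_of_isNilpotent this).eq_zero
      rw [LieModule.traceForm_apply_apply]
      exact this
  obtain ⟨y, hy⟩ := h1
  have hy : ⁅e, ⁅e, y⁆⁆ = e := by simpa using hy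
  have hσy : ⁅e, ⁅e, σ y⁆⁆ = -e := by
    have := congrArg σ hy
    rw [LieEquiv.map_lie, LieEquiv.map_lie, he] at this
    simp only [neg_lie, lie_neg, neg_neg] at this
    exact this
  obtain ⟨f', hf'⟩ : ∃ f' : L, f' = σ y - y := ⟨_, rfl⟩
  have hσf' : σ f' = -f' := by rw [hf', map_sub, hσ]; abel
  have hef' : ⁅e, ⁅e, f'⁆⁆ = (-2 : K) • e := by
    rw [hf']; simp only [lie_sub, hσy, hy]; module
  obtain ⟨h, hh⟩ : ∃ h, h = ⁅e, f'⁆ := ⟨_, rfl⟩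
  have hσh : σ h = h := by rw [hh, LieEquiv.map_lie, he, hσf']; simp
  rw [← hh] at hef'
  have hhe : ⁅h, e⁆ = (2 : K) • e := by rw [← lie_skew, hef']; module
  have hEF : ad K L e * ad K L f' - ad K L f' * ad K L e = ad K L h := by rw [← ad_lie_eq, hh]
  have hHE : ad K L h * ad K L e - ad K L e * ad K L h = (2 : K) • ad K L e := by
    rw [← ad_lie_eq, hhe, map_smul]
  let A : Submodule K L := LinearMap.ker (ad K L e) ⊓ End.eigenspace (σ.toLinearEquiv : L →ₗ[K] L) (-1)
  have hA : ∀ v, v ∈ A ↔ ⁅e, v⁆ = 0 ∧ σ v = -v := by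
    intro v
    simp only [A, Submodule.mem_inf, LinearMap.mem_ker, ad_apply, Module.End.mem_eigenspace_iff]
    simp
  let T : End K L := ad K L h + (2 : K) • 1
  have hTv : ∀ v, T v = ⁅h, v⁆ + (2 : K) • v := fun v => by simp [T]
  have hTA : ∀ v ∈ A, T v ∈ A := by
    intro v hv
    rw [hA] at hv ⊢
    rw [hTv]
    constructor
    · rw [lie_add, leibniz_lie, hef', lie_smul, hv.1]; simp [hv.1]
    · rw [map_add, map_smul, LieEquiv.map_lie, hσh, hv.2]; simp; abel
  have hinj : Function.Injective (T.restrict hTA) := by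
    rw [injective_iff_map_eq_zero]
    intro v hv
    have hv1 : T v = 0 := congrArg (fun q : A => (q : L)) hv
    rw [hTv] at hv1
    by_contra hne
    obtain ⟨n, hn⟩ := aux_eig_nat _ _ _ hEF hHE hnil (v : L) (by simpa using hne)
      ((hA v).mp v.2).1 (-2) (by rw [ad_apply, eq_neg_of_add_eq_zero_left hv1]; module)
    have : ((n + 2 : ℕ) : K) = 0 := by push_cast; linear_combination -hn
    exact absurd (Nat.cast_eq_zero.mp this) (by omega)
  have hsurj := LinearMap.injective_iff_surjective.mp hinj
  have hu : -(⁅h, f'⁆ + (2 : K) • f') ∈ A := by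
    rw [hA]
    constructor
    · rw [lie_neg, lie_add, leibniz_lie, hef', lie_smul, ← hh]; simp [← hh]
    · rw [map_neg, map_add, map_smul, LieEquiv.map_lie, hσh, hσf']; simp; abel
  obtain ⟨z, hz⟩ := hsurj ⟨_, hu⟩
  have hz1 : T z = -(⁅h, f'⁆ + (2 : K) • f') := congrArg (fun q : A => (q : L)) hz
  rw [hTv] at hz1
  have hz2 := (hA z).mp z.2
  refine ⟨f' + z, h, ?_, ?_, hhe, ?_⟩
  · rw [map_add, hσf', hz2.2]; abel
  · rw [lie_add, hz2.1, ← hh, add_zero]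
  · rw [lie_add]
    have : ⁅h, (z : L)⁆ = -(⁅h, f'⁆ + (2 : K) • f') - (2 : K) • (z : L) := by rw [← hz1]; abel
    rw [this]; module

theorem ad_nilp_of_neg (h f : L) (c : K) (hc : c ≠ 0) (hf : ⁅h, f⁆ = c • f) : IsNilpotent (ad K L f) := by
  refine aux_nilp (ad K L f) (ad K L h) c hc ?_
  rw [← ad_lie_eq, hf, map_smul]

theorem exists_exp (f : L) (hf : IsNilpotent (ad K L f)) : ∃ φ : L ≃ₗ⁅K⁆ L, ∀ x,
    ⁅f, ⁅f, ⁅f, x⁆⁆⁆ = 0 → φ x = x + ⁅f, x⁆ + (2 : K)⁻¹ • ⁅f, ⁅f, x⁆⁆ := by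
  let _ : Module ℚ L := Module.compHom L (algebraMap ℚ K)
  have hq : ∀ (q : ℚ) (x : L), q • x = (algebraMap ℚ K q) • x := fun q x => rfl
  let _ : LieAlgebra ℚ L := ⟨fun t x m => by rw [hq, hq, lie_smul]⟩
  have hD : (LieDerivation.ad K L f).toLinearMap = ad K L f := by
    ext v; simp
  have hf' : IsNilpotent (LieDerivation.ad K L f).toLinearMap := by rw [hD]; exact hf
  refine ⟨LieDerivation.exp (LieDerivation.ad K L f) hf', fun x hx => ?_⟩
  rw [LieDerivation.exp_map_apply, hD]
  have h1 := IsNilpotent.exp_smul_eq_sum (a := (ad K L f)) (k := 3) (m := x) hx hf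
  refine h1.trans ?_
  simp [Finset.sum_range_succ, hq, pow_succ]

theorem exists_equiv_sum (e f h : L) (hef : ⁅e, f⁆ = h) (hhe : ⁅h, e⁆ = (2 : K) • e)
    (hhf : ⁅h, f⁆ = (-2 : K) • f) : ∃ φ : L ≃ₗ⁅K⁆ L, φ h = e + f := by
  have heh : ⁅e, h⁆ = (-2 : K) • e := by rw [← lie_skew, hhe]; module
  have hfh : ⁅f, h⁆ = (2 : K) • f := by rw [← lie_skew, hhf]; module
  have hfe : ⁅f, e⁆ = - h := by rw [← lie_skew, hef]
  obtain ⟨φ, hφ⟩ := exists_exp (K := K) ((-2 : K)⁻¹ • e)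
    (ad_nilp_of_neg h _ 2 two_ne_zero (by rw [lie_smul, hhe]; module))
  obtain ⟨ψ, hψ⟩ := exists_exp f (ad_nilp_of_neg h _ (-2 : K) (by simp) hhf)
  refine ⟨φ.trans ψ, ?_⟩
  have h1 : φ h = h + e := by
    rw [hφ]
    · simp [heh]
    · simp [heh]
  have h2 : ⁅f, h + e⁆ = (2 : K) • f - h := by rw [lie_add, hfh, hfe]; abel
  have h3 : ⁅f, ⁅f, h + e⁆⁆ = (-2 : K) • f := by rw [h2]; simp [hfh]
  rw [LieEquiv.trans_apply, h1, hψ, h3, h2]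
  · have : (2 : K)⁻¹ • (-2 : K) • f = - f := by rw [smul_smul]; simp
    rw [this]; module
  · rw [h3]; simp

theorem exists_equiv_nil (e f h : L) (hef : ⁅e, f⁆ = h)
    (hhf : ⁅h, f⁆ = (-2 : K) • f) : ∃ φ : L ≃ₗ⁅K⁆ L, φ e = e + h - f := by
  have hfh : ⁅f, h⁆ = (2 : K) • f := by rw [← lie_skew, hhf]; module
  have hfe : ⁅f, e⁆ = - h := by rw [← lie_skew, hef]
  obtain ⟨ψ, hψ⟩ := exists_exp (-f) (ad_nilp_of_neg h _ (-2 : K) (by simp) (by simp [hhf]))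
  refine ⟨ψ, ?_⟩
  have h2 : ⁅-f, e⁆ = h := by simp [hfe]
  have h3 : ⁅-f, h⁆ = (-2 : K) • f := by simp [hfh]
  rw [hψ, h2, h3]
  · have : (2 : K)⁻¹ • (-2 : K) • f = - f := by rw [smul_smul]; simp
    rw [this]; module
  · rw [h2, h3]; simp

theorem ad_conj (φ : L ≃ₗ⁅K⁆ L) (x : L) :
    ad K L (φ x) = φ.toLinearEquiv.conj (ad K L x) := by
  ext v
  change ⁅φ x, v⁆ = φ ⁅x, φ.symm v⁆
  rw [LieEquiv.map_lie, LieEquiv.apply_symm_apply]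

theorem ker_equiv (φ : L ≃ₗ⁅K⁆ L) (x : L) :
    finrank K (LinearMap.ker (ad K L (φ x))) = finrank K (LinearMap.ker (ad K L x)) := by
  refine (LinearEquiv.finrank_eq (φ.toLinearEquiv.ofSubmodules _ _ ?_)).symm
  ext v
  constructor
  · rintro ⟨u, hu, rfl⟩
    have : ⁅x, u⁆ = 0 := hu
    simp [← LieEquiv.map_lie, this]
  · intro hv
    have hv : ⁅φ x, v⁆ = 0 := hv
    refine ⟨φ.symm v, ?_, by simp⟩
    have := congrArg φ.symm hv
    rw [LieEquiv.map_lie, LieEquiv.symm_apply_apply, map_zero] at this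
    exact this

theorem nilp_equiv (φ : L ≃ₗ⁅K⁆ L) (x : L) (h : IsNilpotent (ad K L x)) :
    IsNilpotent (ad K L (φ x)) := by
  rw [ad_conj]
  exact h.map (φ.toLinearEquiv.conjRingEquiv)

theorem engel_equiv (φ : L ≃ₗ⁅K⁆ L) (x : L) :
    finrank K (LieSubalgebra.engel K (φ x)) = finrank K (LieSubalgebra.engel K x) := by
  rw [finrank_engel, finrank_engel, ad_conj, LinearEquiv.charpoly_conj]

theorem finrank_engel_eq (x : L) :
    finrank K (LieSubalgebra.engel K x) = finrank K ((ad K L x).maxGenEigenspace 0) := by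
  rfl

end PartE


section PartF
set_option linter.unusedSectionVars false

variable {K L : Type*} [Field K] [IsAlgClosed K] [CharZero K] [LieRing L] [LieAlgebra K L]
  [FiniteDimensional K L] [LieAlgebra.IsKilling K L]

theorem ker_le_engel (x : L) : LinearMap.ker (ad K L x) ≤ (LieSubalgebra.engel K x).toSubmodule := by
  intro v hv
  change v ∈ LieSubalgebra.engel K x
  rw [LieSubalgebra.mem_engel_iff]
  exact ⟨1, by simpa using hv⟩

theorem cartan_mem_ker (H : LieSubalgebra K L) [H.IsCartanSubalgebra] (x v : L) (hx : x ∈ H)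
    (hv : v ∈ H) : ⁅x, v⁆ = 0 := by
  have : IsLieAbelian H := LieAlgebra.IsKilling.instIsLieAbelianOfIsCartanSubalgebra K L H
  have := trivial_lie_zero H H ⟨x, hx⟩ ⟨v, hv⟩
  exact congrArg (fun q : H => (q : L)) this

theorem partBack (σ : L ≃ₗ⁅K⁆ L) (hσ : ∀ x, σ (σ x) = x) (e : L) (he : σ e = -e)
    (hnil : IsNilpotent (ad K L e)) (H0 : LieSubalgebra K L) [H0.IsCartanSubalgebra]
    (hreg : finrank K (LinearMap.ker (ad K L e)) = finrank K H0) :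
    ∃ x, σ x = -x ∧ (ad K L x).IsSemisimple ∧ ∃ H : LieSubalgebra K L, H.IsCartanSubalgebra ∧
      finrank K (LinearMap.ker (ad K L x)) = finrank K H := by
  obtain ⟨f, h, hf, hef, hhe, hhf⟩ := gradedJM σ hσ e he hnil
  obtain ⟨φ, hφ⟩ := exists_equiv_sum e f h hef hhe hhf
  have h1 : finrank K (LieSubalgebra.engel K (e + f)) ≤ LieAlgebra.rank K L := by
    rw [← hφ, engel_equiv, finrank_engel_eq]
    refine (partC (ad K L e) (ad K L h) ?_).trans (hreg.le.trans (partB H0))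
    rw [← ad_lie_eq, hhe, map_smul]
  have hC := partA _ h1
  refine ⟨e + f, by rw [map_add, he, hf]; abel, ?_, _, hC, ?_⟩
  · exact IsKilling.isSemisimple_ad_of_mem_isCartanSubalgebra (H := LieSubalgebra.engel K (e + f))
      (LieSubalgebra.self_mem_engel K _)
  · apply congrArg (fun S : Submodule K L => finrank K S)
    refine le_antisymm (ker_le_engel _) ?_
    intro v hv
    exact cartan_mem_ker (LieSubalgebra.engel K (e + f)) _ _ (LieSubalgebra.self_mem_engel K _) hv

theorem ss_ker_eq_engel (x : L) (hx : (ad K L x).IsSemisimple) :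
    LinearMap.ker (ad K L x) = (LieSubalgebra.engel K x).toSubmodule := by
  refine le_antisymm (ker_le_engel _) ?_
  have h1 : (LieSubalgebra.engel K x).toSubmodule = (ad K L x).maxGenEigenspace 0 := rfl
  rw [h1, hx.isFinitelySemisimple.maxGenEigenspace_eq_eigenspace, End.eigenspace_zero]

end PartF

section PartG
set_option linter.unusedSectionVars false

variable {K L : Type*} [Field K] [IsAlgClosed K] [CharZero K] [LieRing L] [LieAlgebra K L]
  [FiniteDimensional K L] [LieAlgebra.IsKilling K L]
  (H : LieSubalgebra K L) [H.IsCartanSubalgebra]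

theorem sigma_mem_rootSpace (σ : L ≃ₗ⁅K⁆ L) (hσ : ∀ x, σ (σ x) = x) (s : H →ₗ[K] H)
    (hs : ∀ h : H, ((s h : H) : L) = σ h) (χ : H → K) (v : L) (hv : v ∈ rootSpace H χ) :
    σ v ∈ rootSpace H (fun h => χ (s h)) := by
  apply LieModule.weightSpace_le_genWeightSpace L (fun h => χ (s h))
  rw [LieModule.mem_weightSpace]
  intro h
  have h1 := IsKilling.lie_eq_smul_of_mem_rootSpace hv (s h)
  have h2 : ⁅h, σ v⁆ = σ ⁅s h, v⁆ := by
    rw [LieSubalgebra.coe_bracket_of_module, LieSubalgebra.coe_bracket_of_module, LieEquiv.map_lie,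
      hs, hσ]
  rw [h2, h1, map_smul]

theorem exists_tau_weight (σ : L ≃ₗ⁅K⁆ L) (hσ : ∀ x, σ (σ x) = x) (s : H →ₗ[K] H)
    (hs : ∀ h : H, ((s h : H) : L) = σ h) (α : LieModule.Weight K H L) :
    ∃ β : LieModule.Weight K H L, ∀ h, β h = -(α (s h)) := by
  obtain ⟨v, hv, hv0⟩ := α.exists_ne_zero
  have h1 := sigma_mem_rootSpace H σ hσ s hs α v hv
  let γ : LieModule.Weight K H L := ⟨fun h => α (s h), by
    intro h
    apply hv0
    have h2 : σ v ∈ (⊥ : LieSubmodule K H L) := h ▸ h1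
    have : σ v = 0 := by simpa using h2
    rw [← hσ v, this, map_zero]⟩
  exact ⟨-γ, fun h => rfl⟩

theorem partG1 (σ : L ≃ₗ⁅K⁆ L) (hσ : ∀ x, σ (σ x) = x) (s : H →ₗ[K] H)
    (hs : ∀ h : H, ((s h : H) : L) = σ h) (x : H) (hx : s x = -x)
    (hreg : ∀ α : LieModule.Weight K H L, α.IsNonZero → α x ≠ 0) :
    ∃ (b : (IsKilling.rootSystem H).Base) (τ : b.support → b.support), (∀ i, τ (τ i) = i) ∧
      ∀ (i : b.support) (h : H), (τ i).1.1 h = -(i.1.1 (s h)) := by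
  classical
  have hss : ∀ h, s (s h) = h := fun h => Subtype.ext (by rw [hs, hs, hσ])
  have hτ0 : ∀ i : H.root, ∃ j : H.root, ∀ h, j.1 h = -(i.1 (s h)) := by
    intro i
    obtain ⟨β, hβ⟩ := exists_tau_weight H σ hσ s hs i.1
    have hnz : β.IsNonZero := by
      intro h0
      apply hreg i.1 (LieSubalgebra.isNonZero_coe_root i) 
      have := congrFun h0 x
      rw [hβ, hx] at this
      have h3 : i.1 (-x) = - i.1 x := map_neg (i.1.toLinear) x
      rw [h3] at this
      simpa using this
    exact ⟨⟨β, by simpa using hnz⟩, hβ⟩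
  choose t ht using hτ0
  set P := IsKilling.rootSystem H with hP
  obtain ⟨φ, hφ⟩ : ∃ f : Dual ℚ K, ∀ i : H.root, f (i.1 x) ≠ 0 :=
    exists_dual_forall_apply_ne_zero (fun i : H.root => i.1 x) fun i =>
      hreg i.1 (LieSubalgebra.isNonZero_coe_root i) 
  let f : Dual K H →+ ℚ := φ.toAddMonoidHom.comp (Dual.eval K H x).toAddMonoidHom
  have hfr : ∀ i, f (P.root i) = φ (i.1 x) := fun i => rfl
  have hf : ∀ i, f (P.root i) ≠ 0 := fun i => by rw [hfr]; exact hφ i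
  let S : Dual K H →ₗ[K] Dual K H := -(s.dualMap)
  have hS : ∀ i, P.root (t i) = S (P.root i) := by
    intro i
    ext h
    exact ht i h
  have hfS : ∀ β, f (S β) = f β := by
    intro β
    change φ (-(β (s x))) = φ (β x)
    rw [hx, map_neg β, neg_neg]
  have htt : ∀ i, t (t i) = i := by
    intro i
    apply Subtype.ext
    apply LieModule.Weight.ext
    intro h
    rw [ht, ht, neg_neg, hss]
  let := P.indexNeg
  let b : P.Base := RootPairing.Base.mk' P (IsAddIndecomposable.baseOf P.root f)
    (P.linearIndepOn_root_baseOf f hf)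
    (fun i ↦ IsAddIndecomposable.mem_or_neg_mem_closure_baseOf P.root f i (hf i) (by simp))
  have hbs : ∀ i, i ∈ b.support ↔ i ∈ IsAddIndecomposable.baseOf P.root f := fun i => by
    simp [b, RootPairing.Base.mk']
  have htb : ∀ i, i ∈ b.support → t i ∈ b.support := by
    intro i hi
    rw [hbs] at hi ⊢
    obtain ⟨h1, h2⟩ := hi
    refine ⟨?_, ?_⟩
    · change 0 < f (P.root (t i))
      rw [hS, hfS]; exact h1
    · intro j hj k hk hjk
      have h3 := h2 (t j) (by change 0 < f (P.root (t j)); rw [hS, hfS]; exact hj)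
        (t k) (by change 0 < f (P.root (t k)); rw [hS, hfS]; exact hk)
        (by rw [hS j, hS k, ← map_add, ← hjk, ← hS, htt])
      exact absurd h3 (by simp [P.ne_zero])
  refine ⟨b, fun i => ⟨t i.1, htb _ i.2⟩, fun i => Subtype.ext (htt _), fun i h => ht _ _⟩

end PartG

section PartG2
set_option linter.unusedSectionVars false

variable {K L : Type*} [Field K] [IsAlgClosed K] [CharZero K] [LieRing L] [LieAlgebra K L]
  [FiniteDimensional K L] [LieAlgebra.IsKilling K L]
  (H : LieSubalgebra K L) [H.IsCartanSubalgebra]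

theorem partG2 (σ : L ≃ₗ⁅K⁆ L) (hσ : ∀ x, σ (σ x) = x) (s : H →ₗ[K] H)
    (hs : ∀ h : H, ((s h : H) : L) = σ h)
    (b : (IsKilling.rootSystem H).Base) (τ : b.support → b.support) (hττ : ∀ i, τ (τ i) = i)
    (hτ : ∀ (i : b.support) (h : H), (τ i).1.1 h = -(i.1.1 (s h))) :
    ∃ (y : H) (r : b.support → K), s y = -y ∧ (∀ i : b.support, i.1.1 y = 2) ∧
      (∀ i, r (τ i) = r i) ∧
      y = ∑ i, r i • (IsKilling.cartanEquivDual H).symm (i.1.1.toLinear) := by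
  classical
  have hss : ∀ h, s (s h) = h := fun h => Subtype.ext (by rw [hs, hs, hσ])
  have hroot : ∀ i : b.support, b.toWeightBasis i = i.1.1.toLinear := fun i => by simp
  let y : H := (evalEquiv K H).symm (b.toWeightBasis.constr K fun _ => (2 : K))
  have hy : ∀ β : Dual K H, β y = b.toWeightBasis.constr K (fun _ => (2 : K)) β := fun β => by
    simp [y]
  have hy2 : ∀ i : b.support, i.1.1 y = 2 := by
    intro i
    have := hy (b.toWeightBasis i)
    rw [Basis.constr_basis, hroot] at this
    exact this
  have hsy : s y = -y := by
    rw [← sub_eq_zero]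
    refine (forall_dual_apply_eq_zero_iff K (s y - -y)).mp ?_
    intro β
    have : (Dual.eval K H (s y - -y)) = 0 := by
      apply b.toWeightBasis.ext
      intro i
      rw [hroot]
      change (LieModule.Weight.toLinear K H L i.1.1) (s y - - y) = 0
      rw [map_sub, map_neg]
      change i.1.1 (s y) - - i.1.1 y = 0
      have h1 := hτ i y
      rw [hy2] at h1
      rw [hy2, ← neg_neg (i.1.1 (s y)), ← h1]
      ring
    exact congrArg (fun F => F β) this
  set T : b.support → H := fun i => (IsKilling.cartanEquivDual H).symm (i.1.1.toLinear) with hT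
  have hκ : ∀ u v : H, IsKilling.cartanEquivDual H u v = killingForm K L u v := fun u v => rfl
  have hsT : ∀ i, s (T i) = - T (τ i) := by
    intro i
    apply (IsKilling.cartanEquivDual H).injective
    ext h
    rw [hκ, hs, map_neg, LinearMap.neg_apply, LinearEquiv.apply_symm_apply]
    change _ = - ((τ i).1.1 h)
    rw [hτ, neg_neg]
    have h1 : killingForm K L (σ (T i)) h = killingForm K L (T i) (s h : H) := by
      rw [← killingForm_of_equiv_apply σ, hs, hσ]
    rw [h1, ← hκ, LinearEquiv.apply_symm_apply]
    rfl
  let B := b.toWeightBasis.map (IsKilling.cartanEquivDual H).symm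
  have hB : ∀ i, B i = T i := fun i => by simp [B, hT]
  have hyr : y = ∑ i, B.repr y i • T i := by
    conv_lhs => rw [← B.sum_repr y]
    simp only [hB]
  have hyr2 : y = ∑ i, B.repr y (τ i) • T i := by
    have h1 : y = - s y := by rw [hsy, neg_neg]
    have h2 : y = ∑ i, B.repr y i • T (τ i) := by
      conv_lhs => rw [h1, hyr, map_sum, ← Finset.sum_neg_distrib]
      refine Finset.sum_congr rfl fun i _ => ?_
      rw [map_smul, hsT, smul_neg, neg_neg]
    conv_lhs => rw [h2]
    refine Fintype.sum_equiv ⟨τ, τ, hττ, hττ⟩ _ _ fun i => ?_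
    simp [hττ]
  refine ⟨y, fun i => (2 : K)⁻¹ * (B.repr y i + B.repr y (τ i)), hsy, hy2, fun i => ?_, ?_⟩
  · simp only [hττ]; ring
  · have h3 : ∀ i, ((2 : K)⁻¹ * (B.repr y i + B.repr y (τ i))) • T i =
      (2:K)⁻¹ • (B.repr y i • T i + B.repr y (τ i) • T i) := fun i => by
        rw [← add_smul, smul_smul]
    change y = ∑ i, ((2 : K)⁻¹ * (B.repr y i + B.repr y (τ i))) • T i
    rw [Finset.sum_congr rfl fun i _ => h3 i]
    rw [← Finset.smul_sum, Finset.sum_add_distrib, ← hyr, ← hyr2, ← two_smul K y, smul_smul]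
    simp

theorem partG3 (σ : L ≃ₗ⁅K⁆ L) (hσ : ∀ x, σ (σ x) = x) (s : H →ₗ[K] H)
    (hs : ∀ h : H, ((s h : H) : L) = σ h)
    (b : (IsKilling.rootSystem H).Base) (τ : b.support → b.support) (hττ : ∀ i, τ (τ i) = i)
    (hτ : ∀ (i : b.support) (h : H), (τ i).1.1 h = -(i.1.1 (s h)))
    (y : H) (r : b.support → K) (hy2 : ∀ i : b.support, i.1.1 y = 2)
    (hr : ∀ i, r (τ i) = r i)
    (hyr : y = ∑ i, r i • (IsKilling.cartanEquivDual H).symm (i.1.1.toLinear)) :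
    ∃ e : L, ⁅(y : L), e⁆ = (2 : K) • e ∧ ⁅e, σ e⁆ = y := by
  classical
  have hnz : ∀ i : b.support, i.1.1.IsNonZero := fun i => LieSubalgebra.isNonZero_coe_root i.1
  have hss : ∀ h, s (s h) = h := fun h => Subtype.ext (by rw [hs, hs, hσ])
  choose e he he0 using fun i : b.support => i.1.1.exists_ne_zero
  have hσe : ∀ i, σ (e (τ i)) ∈ rootSpace H (-(i.1.1 : H → K)) := by
    intro i
    have h1 := sigma_mem_rootSpace H σ hσ s hs _ _ (he (τ i))
    have h2 : (fun h => (τ i).1.1 (s h)) = -(i.1.1 : H → K) := by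
      funext h
      rw [hτ, hss]; rfl
    rwa [h2] at h1
  let q : b.support → K := fun i => killingForm K L (e i) (σ (e (τ i)))
  have hq0 : ∀ i, q i ≠ 0 := by
    intro i hq
    apply he0 i
    have := LieAlgebra.mem_ker_killingForm_of_mem_rootSpace_of_forall_rootSpace_neg K L H (he i) ?_
    · simpa using this
    · intro z hz
      have hne : (⟨_, hσe i⟩ : rootSpace H (-(i.1.1 : H → K))) ≠ 0 := by
        intro h0
        apply he0 (τ i)
        have h0' : σ (e (τ i)) = 0 := congrArg Subtype.val h0
        rw [← hσ (e (τ i)), h0', map_zero]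
      obtain ⟨c, hc⟩ := (finrank_eq_one_iff_of_nonzero' _ hne).mp
        (IsKilling.finrank_rootSpace_eq_one (-i.1.1) (by simpa using hnz i)) ⟨z, hz⟩
      have hc' : c • σ (e (τ i)) = z := congrArg Subtype.val hc
      rw [← hc', map_smul]
      change c • q i = 0
      rw [hq, smul_zero]
  have hqτ : ∀ i, q (τ i) = q i := by
    intro i
    change killingForm K L (e (τ i)) (σ (e (τ (τ i)))) = killingForm K L (e i) (σ (e (τ i)))
    rw [hττ, LieModule.traceForm_comm K L L (e i), ← killingForm_of_equiv_apply σ, hσ]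
  choose sq hsq using fun z : K => IsAlgClosed.exists_pow_nat_eq z (n := 2) (by norm_num)
  let c : b.support → K := fun i => sq (r i / q i)
  have hcτ : ∀ i, c (τ i) = c i := fun i => by simp only [c, hr, hqτ]
  have hc : ∀ i, c i * c i * q i = r i := fun i => by
    rw [← pow_two, hsq, div_mul_cancel₀ _ (hq0 i)]
  refine ⟨∑ i, c i • e i, ?_, ?_⟩
  · rw [lie_sum, Finset.smul_sum]
    refine Finset.sum_congr rfl fun i _ => ?_
    have := IsKilling.lie_eq_smul_of_mem_rootSpace (he i) y
    rw [hy2] at this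
    change ⁅(y : L), e i⁆ = _ at this
    rw [lie_smul, this, smul_comm]
  · have h1 : σ (∑ i, c i • e i) = ∑ i, c i • σ (e (τ i)) := by
      rw [map_sum]
      refine Fintype.sum_equiv ⟨τ, τ, hττ, hττ⟩ _ _ fun i => ?_
      simp [hττ, hcτ]
    have hoff : ∀ i j, i ≠ j → ⁅e i, σ (e (τ j))⁆ = 0 := by
      intro i j hij
      have h2 := LieAlgebra.lie_mem_genWeightSpace_of_mem_genWeightSpace (he i) (hσe j)
      by_contra h3
      have h4 : LieModule.genWeightSpace L ((i.1.1 : H → K) + -(j.1.1 : H → K)) ≠ ⊥ := by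
        intro h5
        rw [h5] at h2
        exact h3 (by simpa using h2)
      let β : LieModule.Weight K H L := ⟨_, h4⟩
      have hβ : β.toLinear = i.1.1.toLinear - j.1.1.toLinear := by
        ext h
        change i.1.1 h + - j.1.1 h = i.1.1 h - j.1.1 h
        ring
      have hβ0 : β.IsNonZero := by
        intro h0
        apply hij
        apply Subtype.ext
        apply (IsKilling.rootSystem H).root.injective
        change i.1.1.toLinear = j.1.1.toLinear
        rw [← sub_eq_zero, ← hβ]
        ext h
        exact congrFun h0 h
      exact b.sub_notMem_range_root i.2 j.2 ⟨⟨β, by simpa using hβ0⟩, hβ⟩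
    rw [h1, sum_lie]
    have h6 : (y : L) = ∑ i, r i •
        (((IsKilling.cartanEquivDual H).symm (i.1.1.toLinear) : H) : L) := by
      conv_lhs => rw [hyr]
      simp
    rw [h6]
    refine Finset.sum_congr rfl fun i _ => ?_
    rw [lie_sum, Finset.sum_eq_single i]
    · rw [lie_smul, smul_lie,
        IsKilling.lie_eq_killingForm_smul_of_mem_rootSpace_of_mem_rootSpace_neg (he i) (hσe i),
        smul_smul, smul_smul]
      congr 1
      exact hc i
    · intro j _ hj
      rw [lie_smul, smul_lie, hoff i j hj.symm, smul_zero, smul_zero]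
    · simp

end PartG2

section PartG4
set_option linter.unusedSectionVars false

variable {K L : Type*} [Field K] [IsAlgClosed K] [CharZero K] [LieRing L] [LieAlgebra K L]
  [FiniteDimensional K L] [LieAlgebra.IsKilling K L]
  (H : LieSubalgebra K L) [H.IsCartanSubalgebra]

theorem weight_height (b : (IsKilling.rootSystem H).Base) (y : H)
    (hy2 : ∀ i : b.support, i.1.1 y = 2) (χ : LieModule.Weight K H L) (hχ : χ.IsNonZero) :
    ∃ m : ℤ, m ≠ 0 ∧ χ y = 2 * m := by
  let i : H.root := ⟨χ, by simpa using hχ⟩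
  obtain ⟨f, -, -, hf⟩ := b.exists_root_eq_sum_int i
  refine ⟨b.height i, b.height_ne_zero i, ?_⟩
  rw [RootPairing.Base.height_eq_sum hf]
  have h1 : χ y = (IsKilling.rootSystem H).root i y := rfl
  rw [h1, hf, LinearMap.sum_apply, Int.cast_sum, Finset.mul_sum]
  refine Finset.sum_congr rfl fun j hj => ?_
  have h2 : (IsKilling.rootSystem H).root j y = 2 := hy2 ⟨j, hj⟩
  rw [LinearMap.smul_apply, h2, zsmul_eq_mul, mul_comm]

theorem partG4 (b : (IsKilling.rootSystem H).Base) (y : H)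
    (hy2 : ∀ i : b.support, i.1.1 y = 2) :
    (⨆ μ ∈ Set.range (fun m : ℤ => (2 * m : K)), (ad K L y).eigenspace μ) = ⊤ ∧
      LinearMap.ker (ad K L y) = H.toSubmodule := by
  have heig : ∀ (χ : LieModule.Weight K H L) (v : L), v ∈ rootSpace H χ →
      v ∈ (ad K L y).eigenspace (χ y) := by
    intro χ v hv
    rw [End.mem_eigenspace_iff]
    exact IsKilling.lie_eq_smul_of_mem_rootSpace hv y
  have hzero : ∀ (χ : LieModule.Weight K H L) (v : L), χ.IsZero → v ∈ rootSpace H χ → v ∈ H := by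
    intro χ v h0 hv
    have h1 : (χ : H → K) = 0 := h0
    rw [h1] at hv
    simpa using hv
  have hind : ∀ (Q : Submodule K L),
      (∀ (χ : LieModule.Weight K H L) (v : L), v ∈ rootSpace H χ → v ∈ Q) → Q = ⊤ := by
    intro Q hQ
    rw [eq_top_iff]
    intro v _
    have hv : v ∈ (⨆ χ : LieModule.Weight K H L, rootSpace H χ) := by
      rw [LieModule.iSup_genWeightSpace_eq_top' K H L]; trivial
    induction hv using LieSubmodule.iSup_induction' with
    | mem χ w hw => exact hQ χ w hw
    | zero => exact Q.zero_mem
    | add u w _ _ hu hw => exact Q.add_mem (hu trivial) (hw trivial)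
  refine ⟨hind _ ?_, ?_⟩
  · intro χ v hv
    have h1 := heig χ v hv
    have h2 : χ y ∈ Set.range (fun m : ℤ => (2 * m : K)) := by
      by_cases h0 : χ.IsZero
      · exact ⟨0, by rw [show χ y = 0 from congrFun h0 y]; simp⟩
      · obtain ⟨m, -, hm⟩ := weight_height H b y hy2 χ h0
        exact ⟨m, hm.symm⟩
    exact (le_iSup₂ (f := fun μ (_ : μ ∈ Set.range (fun m : ℤ => (2 * m : K))) =>
      (ad K L y).eigenspace μ) _ h2) h1
  · have hle : H.toSubmodule ≤ LinearMap.ker (ad K L y) := fun v hv =>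
      cartan_mem_ker H _ _ y.2 hv
    refine le_antisymm ?_ hle
    let W : Submodule K L := ⨆ μ, ⨆ (_ : μ ≠ 0), (ad K L y).eigenspace μ
    have hsup : H.toSubmodule ⊔ W = ⊤ := by
      apply hind
      intro χ v hv
      by_cases h0 : χ.IsZero
      · exact Submodule.mem_sup_left (hzero χ v h0 hv)
      · apply Submodule.mem_sup_right
        obtain ⟨m, hm0, hm⟩ := weight_height H b y hy2 χ h0
        have h2 : χ y ≠ 0 := by
          rw [hm]
          exact mul_ne_zero two_ne_zero (by exact_mod_cast hm0)
        exact (le_iSup₂ (f := fun μ (_ : μ ≠ 0) => (ad K L y).eigenspace μ) _ h2) (heig χ v hv)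
    have hdis : Disjoint (LinearMap.ker (ad K L y)) W := by
      have := (End.eigenspaces_iSupIndep (ad K L (y : L))) 0
      rwa [End.eigenspace_zero] at this
    intro v hv
    have hv' : v ∈ H.toSubmodule ⊔ W := by rw [hsup]; trivial
    obtain ⟨h, hh, w, hw, rfl⟩ := Submodule.mem_sup.mp hv'
    have h3 : w ∈ LinearMap.ker (ad K L (y:L)) := by
      have := Submodule.sub_mem _ hv (hle hh)
      simpa using this
    have h4 : w = 0 := Submodule.disjoint_def.mp hdis w h3 hw
    rw [h4, add_zero]; exact hh

theorem partForth (σ : L ≃ₗ⁅K⁆ L) (hσ : ∀ x, σ (σ x) = x) (x : L) (hx : σ x = -x)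
    (hss : (ad K L x).IsSemisimple) (H0 : LieSubalgebra K L) [H0.IsCartanSubalgebra]
    (hreg : finrank K (LinearMap.ker (ad K L x)) = finrank K H0) :
    ∃ e, σ e = -e ∧ IsNilpotent (ad K L e) ∧ ∃ H : LieSubalgebra K L, H.IsCartanSubalgebra ∧
      finrank K (LinearMap.ker (ad K L e)) = finrank K H := by
  have hker := ss_ker_eq_engel x hss
  have hC : (LieSubalgebra.engel K x).IsCartanSubalgebra := by
    apply partA
    have h1 : finrank K (LieSubalgebra.engel K x) = finrank K (LinearMap.ker (ad K L x)) := by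
      rw [hker]; rfl
    rw [h1, hreg]
    exact partB H0
  generalize hH : LieSubalgebra.engel K x = H at *
  have hxH : x ∈ H := hH ▸ LieSubalgebra.self_mem_engel K x
  have hmem : ∀ v, v ∈ H ↔ ⁅x, v⁆ = 0 := by
    intro v
    have : v ∈ LinearMap.ker (ad K L x) ↔ v ∈ H.toSubmodule := by rw [hker]
    simpa using this.symm
  have hσH : ∀ v ∈ H, σ v ∈ H := by
    intro v hv
    rw [hmem] at hv ⊢
    have h1 : σ ⁅x, v⁆ = -⁅x, σ v⁆ := by rw [LieEquiv.map_lie, hx, neg_lie]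
    rw [hv, map_zero] at h1
    exact neg_eq_zero.mp h1.symm
  let s : H →ₗ[K] H := (σ : L →ₗ[K] L).restrict (p := H.toSubmodule) (q := H.toSubmodule) hσH
  have hs : ∀ h : H, ((s h : H) : L) = σ h := fun h => rfl
  let x' : H := ⟨x, hxH⟩
  have hsx : s x' = -x' := Subtype.ext hx
  have hnz : ∀ α : LieModule.Weight K H L, α.IsNonZero → α x' ≠ 0 := by
    intro α hα h0
    obtain ⟨v, hv, hv0⟩ := α.exists_ne_zero
    have h1 := IsKilling.lie_eq_smul_of_mem_rootSpace hv x'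
    rw [h0, zero_smul] at h1
    have h2 : v ∈ H := (hmem v).mpr h1
    have h3 : v ∈ rootSpace H (0 : H → K) := by simpa using h2
    have h4 := LieModule.disjoint_genWeightSpace K H L (χ₁ := α) (χ₂ := (0 : H → K)) hα
    apply hv0
    have := Submodule.disjoint_def.mp (LieSubmodule.disjoint_toSubmodule.mpr h4) v hv h3
    exact this
  obtain ⟨b, τ, hττ, hτ⟩ := partG1 H σ hσ s hs x' hsx hnz
  obtain ⟨y, r, hsy, hy2, hr, hyr⟩ := partG2 H σ hσ s hs b τ hττ hτ
  obtain ⟨e, hye, hef⟩ := partG3 H σ hσ s hs b τ hττ hτ y r hy2 hr hyr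
  obtain ⟨htop, hkery⟩ := partG4 H b y hy2
  have hσy : σ (y : L) = -(y : L) := by
    rw [← hs, hsy]; rfl
  have hyf : ⁅(y : L), σ e⁆ = (-2 : K) • σ e := by
    have h1 : σ ⁅(y : L), e⁆ = -⁅(y : L), σ e⁆ := by rw [LieEquiv.map_lie, hσy, neg_lie]
    rw [hye, map_smul] at h1
    rw [neg_smul, h1, neg_neg]
  have hnil : IsNilpotent (ad K L e) := ad_nilp_of_neg (y : L) e 2 two_ne_zero hye
  have hHE : ad K L y * ad K L e - ad K L e * ad K L y = (2 : K) • ad K L e := by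
    rw [← ad_lie_eq, hye, map_smul]
  have hEF : ad K L e * ad K L (σ e) - ad K L (σ e) * ad K L e = ad K L y := by
    rw [← ad_lie_eq, hef]
  have hup : finrank K (LinearMap.ker (ad K L e)) ≤ finrank K H := by
    have h1 := partC' (killingForm K L) kill_nondeg kill_symm (ad K L e) (ad K L (σ e)) (ad K L y)
      hEF hHE hnil (kill_skew e) (kill_skew (y : L)) htop
    rw [hkery] at h1
    exact h1
  have hlo : finrank K H ≤ finrank K (LinearMap.ker (ad K L e)) := by
    have h1 := partC (ad K L e) (ad K L y) hHE
    refine le_trans ?_ h1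
    rw [← finrank_engel_eq]
    have h2 := Submodule.finrank_mono (ker_le_engel (K := K) (y : L))
    rw [hkery] at h2
    exact h2
  obtain ⟨φ, hφ⟩ := exists_equiv_nil e (σ e) (y : L) hef hyf
  refine ⟨φ e, ?_, ?_, H, hC, ?_⟩
  · rw [hφ, map_sub, map_add, hσ, hσy]; abel
  · exact nilp_equiv φ e hnil
  · rw [ker_equiv]; exact le_antisymm hup hlo

end PartG4

/-- For an involution `σ` of the semisimple Lie algebra `g` with
`Z₂`-grading `g = g₀ ⊕ g₁`, the `(-1)`-eigenspace `g₁` contains a regular semisimple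
element of `g` iff it contains a regular nilpotent element of `g`. -/
theorem regular_semisimple_iff_regular_nilpotent (σ : g ≃ₗ⁅k⁆ g)
    (hσ : IsInvolution k g σ) :
    (∃ x ∈ eigSub k g σ (-1), IsSSElt k g x ∧ IsRegElt k g x) ↔
      (∃ x ∈ eigSub k g σ (-1), IsNilpElt k g x ∧ IsRegElt k g x) := by
  have hK : LieAlgebra.IsKilling k g := inferInstance
  have hm : ∀ x : g, x ∈ eigSub k g σ (-1) ↔ σ x = -x := by
    intro x
    unfold eigSub
    rw [End.mem_eigenspace_iff, neg_smul, one_smul]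
    rfl
  constructor
  · rintro ⟨x, hx, hs, H0, hH0, hr⟩
    obtain ⟨e, he, hn, H, hH, hreg⟩ := partForth σ hσ x ((hm x).mp hx) hs H0 hr
    exact ⟨e, (hm e).mpr he, hn, H, hH, hreg⟩
  · rintro ⟨x, hx, hn, H0, hH0, hr⟩
    obtain ⟨e, he, hs, H, hH, hreg⟩ := partBack σ hσ x ((hm x).mp hx) hn H0 hr
    exact ⟨e, (hm e).mpr he, hs, H, hH, hreg⟩
end

section
/- Let σ be an involution of g of maximal rank and let x ∈ g₁ be a semisimple element. Then the centralizer z_g(x) is σ-stable, and the restriction of σ to z_g(x) is again of maximal rank, i.e., the (−1)-eigenspace of σ in z_g(x) contains a Cartan subalgebra of z_g(x); the same holds for the restriction of σ to the derived subalgebra [z_g(x), z_g(x)]. -/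
open LieAlgebra Module

variable (k : Type*) [Field k] [IsAlgClosed k] [CharZero k]
variable (g : Type*) [LieRing g] [LieAlgebra k g] [FiniteDimensional k g]
  [LieAlgebra.IsSemisimple k g]

namespace MaxRankAux
open MvPolynomial

section poly
variable {k : Type*} [Field k] {g : Type*} [LieRing g] [LieAlgebra k g]
variable {ι : Type*} [Fintype ι] [DecidableEq ι] (b : Basis ι k g)

/-- directional derivative -/
noncomputable def dV (v : g) : Derivation k (MvPolynomial ι k) (MvPolynomial ι k) :=
  mkDerivation k (fun i => C (b.repr v i))

/-- derivative along the linear vector field of `z` -/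
noncomputable def dZ (z : g) : Derivation k (MvPolynomial ι k) (MvPolynomial ι k) :=
  mkDerivation k (fun i => ∑ j, C (b.repr ⁅z, b j⁆ i) * X j)

lemma dV_X (v : g) (i : ι) : dV b v (X i) = C (b.repr v i) := mkDerivation_X ..
lemma dZ_X (z : g) (i : ι) : dZ b z (X i) = ∑ j, C (b.repr ⁅z, b j⁆ i) * X j :=
  mkDerivation_X ..

lemma dV_C (v : g) (a : k) : dV b v (C a) = 0 := Derivation.map_algebraMap _ _
lemma dZ_C (v : g) (a : k) : dZ b v (C a) = 0 := Derivation.map_algebraMap _ _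

lemma dV_add (v w : g) (Q : MvPolynomial ι k) : dV b (v + w) Q = dV b v Q + dV b w Q := by
  have : dV b (v + w) = dV b v + dV b w := by
    apply MvPolynomial.derivation_ext
    intro i
    simp [dV_X]
  rw [this]; rfl

lemma dV_comm (v w : g) (Q : MvPolynomial ι k) : dV b v (dV b w Q) = dV b w (dV b v Q) := by
  have : ⁅dV b v, dV b w⁆ = 0 := by
    apply MvPolynomial.derivation_ext
    intro i
    simp [Derivation.commutator_apply, dV_X, dV_C]
  have h2 := congrArg (fun D => D Q) this
  simp only [Derivation.commutator_apply, Derivation.coe_zero, Pi.zero_apply] at h2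
  exact sub_eq_zero.mp h2

lemma repr_lie (z y : g) (i : ι) :
    b.repr ⁅z, y⁆ i = ∑ j, b.repr ⁅z, b j⁆ i * b.repr y j := by
  conv_lhs => rw [← b.sum_repr y]
  simp only [lie_sum, lie_smul, map_sum, map_smul, Finsupp.coe_finsetSum, Finset.sum_apply,
    Finsupp.smul_apply, smul_eq_mul]
  exact Finset.sum_congr rfl fun j _ => mul_comm _ _

lemma dZ_dV (z v : g) (Q : MvPolynomial ι k) :
    dZ b z (dV b v Q) = dV b v (dZ b z Q) - dV b ⁅z, v⁆ Q := by
  have : ⁅dZ b z, dV b v⁆ = - dV b ⁅z, v⁆ := by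
    apply MvPolynomial.derivation_ext
    intro i
    simp only [Derivation.commutator_apply, dV_X, dZ_X, dZ_C, map_sum, Derivation.leibniz, dV_C,
      Derivation.neg_apply, smul_eq_mul, repr_lie b z v i, map_mul, zero_sub, mul_zero, add_zero]
  have h2 := congrArg (fun D => D Q) this
  simp only [Derivation.commutator_apply, Derivation.neg_apply] at h2
  linear_combination h2

lemma eval_dZ (z y : g) (Q : MvPolynomial ι k) :
    eval (b.repr y) (dZ b z Q) = eval (b.repr y) (dV b ⁅z, y⁆ Q) := by
  induction Q using MvPolynomial.induction_on with
  | C a => simp [dV_C, dZ_C]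
  | add p q hp hq => simp [hp, hq]
  | mul_X p i hp =>
    simp only [Derivation.leibniz, smul_eq_mul, map_add, map_mul, hp, dV_X, dZ_X, map_sum,
      eval_X, eval_C, repr_lie b z y i]

/-- restriction to a line -/
noncomputable def psi (y v : g) : MvPolynomial ι k →ₐ[k] Polynomial k :=
  aeval (fun i => Polynomial.C (b.repr y i) + Polynomial.X * Polynomial.C (b.repr v i))

lemma derivative_psi (y v : g) (Q : MvPolynomial ι k) :
    Polynomial.derivative (psi b y v Q) = psi b y v (dV b v Q) := by
  induction Q using MvPolynomial.induction_on with
  | C a => simp [dV_C, psi, ← Polynomial.C_eq_algebraMap]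
  | add p q hp hq => simp [hp, hq]
  | mul_X p i hp =>
    simp only [Derivation.leibniz, smul_eq_mul, map_add, map_mul, Polynomial.derivative_mul, hp,
      dV_X]
    simp [psi, ← Polynomial.C_eq_algebraMap]
    ring

lemma eval_psi (y v : g) (s : k) (Q : MvPolynomial ι k) :
    (psi b y v Q).eval s = eval (b.repr (y + s • v)) Q := by
  induction Q using MvPolynomial.induction_on with
  | C a => simp [psi, ← Polynomial.C_eq_algebraMap]
  | add p q hp hq => simp [hp, hq]
  | mul_X p i hp =>
    simp only [map_mul, Polynomial.eval_mul, hp]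
    simp [psi]
    left; ring

variable [CharZero k]

lemma dV_vanish (W : Submodule k g) (Q : MvPolynomial ι k)
    (hQ : ∀ y ∈ W, eval (b.repr y) Q = 0) (w : g) (hw : w ∈ W) :
    ∀ y ∈ W, eval (b.repr y) (dV b w Q) = 0 := by
  intro y hy
  have h0 : psi b y w Q = 0 := by
    apply Polynomial.funext
    intro s
    rw [eval_psi, Polynomial.eval_zero]
    exact hQ _ (W.add_mem hy (W.smul_mem _ hw))
  have h1 := eval_psi b y w 0 (dV b w Q)
  rw [← derivative_psi, h0] at h1
  simpa using h1.symm

/-- iterated derivatives in directions `V` -/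
noncomputable def MM (V : Submodule k g) (P : MvPolynomial ι k) :
    ℕ → Submodule k (MvPolynomial ι k)
  | 0 => Submodule.span k {P}
  | n + 1 => Submodule.span k {R | ∃ v ∈ V, ∃ Q ∈ MM V P n, R = dV b v Q}

lemma MM_succ (V : Submodule k g) (P : MvPolynomial ι k) (n : ℕ) : MM b V P (n+1) =
    Submodule.span k {R | ∃ v ∈ V, ∃ Q ∈ MM b V P n, R = dV b v Q} := rfl

lemma mem_MM_succ (V : Submodule k g) (P : MvPolynomial ι k) (n : ℕ) (v : g) (hv : v ∈ V)
    (Q : MvPolynomial ι k) (hQ : Q ∈ MM b V P n) : dV b v Q ∈ MM b V P (n+1) := by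
  rw [MM_succ]
  exact Submodule.subset_span ⟨v, hv, Q, hQ, rfl⟩

lemma dZ_MM (V : Submodule k g) (P : MvPolynomial ι k) (z : g) (hP : dZ b z P = 0)
    (hz : ∀ v ∈ V, ⁅z, v⁆ ∈ V) (n : ℕ) : ∀ Q ∈ MM b V P n, dZ b z Q ∈ MM b V P n := by
  induction n with
  | zero =>
    intro Q hQ
    obtain ⟨a, rfl⟩ := Submodule.mem_span_singleton.mp hQ
    rw [Derivation.map_smul, hP, smul_zero]
    exact Submodule.zero_mem _
  | succ n ih =>
    intro Q hQ
    rw [MM_succ] at hQ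
    induction hQ using Submodule.span_induction with
    | mem R hR =>
      obtain ⟨v, hv, Q, hQ, rfl⟩ := hR
      rw [dZ_dV]
      exact Submodule.sub_mem _ (mem_MM_succ b V P n v hv _ (ih Q hQ))
        (mem_MM_succ b V P n _ (hz v hv) _ hQ)
    | zero => rw [map_zero]; exact Submodule.zero_mem _
    | add p q _ _ hp hq => rw [map_add]; exact Submodule.add_mem _ hp hq
    | smul a p _ hp => rw [Derivation.map_smul]; exact Submodule.smul_mem _ _ hp

lemma MM_vanish (W : Submodule k g) (P : MvPolynomial ι k)
    (hP : ∀ y ∈ W, eval (b.repr y) P = 0) (n : ℕ) :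
    ∀ Q ∈ MM b W P n, ∀ y ∈ W, eval (b.repr y) Q = 0 := by
  induction n with
  | zero =>
    intro Q hQ y hy
    obtain ⟨a, rfl⟩ := Submodule.mem_span_singleton.mp hQ
    simp [hP y hy]
  | succ n ih =>
    intro Q hQ y hy
    rw [MM] at hQ
    induction hQ using Submodule.span_induction with
    | mem R hR =>
      obtain ⟨v, hv, Q, hQ, rfl⟩ := hR
      exact dV_vanish b W Q (ih Q hQ) v hv y hy
    | zero => simp
    | add p q _ _ hp hq => simp [hp, hq]
    | smul a p _ hp => simp [hp]

lemma MM_split (V W : Submodule k g) (Z : Set g) (x : g) (P : MvPolynomial ι k)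
    (hWV : W ≤ V)
    (hV : ∀ v ∈ V, ∃ w ∈ W, ∃ z ∈ Z, v = w + ⁅z, x⁆) (n : ℕ) :
    MM b V P (n+1) ≤ MM b W P (n+1) ⊔
      Submodule.span k {R | ∃ z ∈ Z, ∃ Q ∈ MM b V P n, R = dV b ⁅z, x⁆ Q} := by
  induction n with
  | zero =>
    conv_lhs => rw [MM]
    rw [Submodule.span_le]
    rintro R ⟨v, hv, Q, hQ, rfl⟩
    obtain ⟨w, hw, z, hz, rfl⟩ := hV v hv
    rw [dV_add]
    exact Submodule.add_mem_sup (Submodule.subset_span ⟨w, hw, Q, hQ, rfl⟩)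
      (Submodule.subset_span ⟨z, hz, Q, hQ, rfl⟩)
  | succ n ih =>
    conv_lhs => rw [MM]
    rw [Submodule.span_le]
    rintro R ⟨v, hv, Q, hQ, rfl⟩
    obtain ⟨w, hw, z, hz, rfl⟩ := hV v hv
    rw [dV_add]
    refine Submodule.add_mem _ ?_ (Submodule.mem_sup_right
      (Submodule.subset_span ⟨z, hz, Q, hQ, rfl⟩))
    obtain ⟨Q1, h1, Q2, h2, rfl⟩ := Submodule.mem_sup.mp (ih hQ)
    rw [map_add]
    refine Submodule.add_mem_sup (Submodule.subset_span ⟨w, hw, Q1, h1, rfl⟩) ?_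
    clear hQ
    induction h2 using Submodule.span_induction with
    | mem R hR =>
      obtain ⟨z', hz', Q, hQ, rfl⟩ := hR
      rw [dV_comm]
      exact Submodule.subset_span ⟨z', hz', _, Submodule.subset_span ⟨w, hWV hw, Q, hQ, rfl⟩, rfl⟩
    | zero => simp
    | add p q _ _ hp hq => rw [map_add]; exact Submodule.add_mem _ hp hq
    | smul a p _ hp => rw [Derivation.map_smul]; exact Submodule.smul_mem _ _ hp

/-- The main density statement. -/
lemma vanish_of_vanish_slice (V W : Submodule k g) (Z : Set g) (x : g) (P : MvPolynomial ι k)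
    (hWV : W ≤ V) (hx : x ∈ W)
    (hV : ∀ v ∈ V, ∃ w ∈ W, ∃ z ∈ Z, v = w + ⁅z, x⁆)
    (hZP : ∀ z ∈ Z, dZ b z P = 0) (hZV : ∀ z ∈ Z, ∀ v ∈ V, ⁅z, v⁆ ∈ V)
    (hP : ∀ y ∈ W, eval (b.repr y) P = 0) :
    ∀ y ∈ V, eval (b.repr y) P = 0 := by
  have key : ∀ n, ∀ Q ∈ MM b V P n, eval (b.repr x) Q = 0 := by
    intro n
    induction n with
    | zero =>
      intro Q hQ
      obtain ⟨a, rfl⟩ := Submodule.mem_span_singleton.mp hQ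
      simp [hP x hx]
    | succ n ih =>
      intro Q hQ
      obtain ⟨Q1, h1, Q2, h2, rfl⟩ := Submodule.mem_sup.mp (MM_split b V W Z x P hWV hV n hQ)
      rw [map_add, MM_vanish b W P hP _ Q1 h1 x hx, zero_add]
      clear hQ
      induction h2 using Submodule.span_induction with
      | mem R hR =>
        obtain ⟨z, hz, Q, hQ, rfl⟩ := hR
        rw [← eval_dZ]
        exact ih _ (dZ_MM b V P z (hZP z hz) (hZV z hz) n Q hQ)
      | zero => simp
      | add p q _ _ hp hq => simp [hp, hq]
      | smul a p _ hp => simp [hp]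
  intro y hy
  set v := y - x with hv
  have hvV : v ∈ V := V.sub_mem hy (hWV hx)
  have hmem : ∀ n, (fun Q => dV b v Q)^[n] P ∈ MM b V P n := by
    intro n
    induction n with
    | zero => exact Submodule.subset_span rfl
    | succ n ih =>
      rw [Function.iterate_succ_apply']
      exact Submodule.subset_span ⟨v, hvV, _, ih, rfl⟩
  have hder : ∀ n, (Polynomial.derivative)^[n] (psi b x v P)
      = psi b x v ((fun Q => dV b v Q)^[n] P) := by
    intro n
    induction n with
    | zero => rfl
    | succ n ih =>
      rw [Function.iterate_succ_apply', Function.iterate_succ_apply', ih, derivative_psi]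
  have hpsi : psi b x v P = 0 := by
    ext n
    have h1 := eval_psi b x v 0 ((fun Q => dV b v Q)^[n] P)
    rw [← hder, zero_smul, add_zero, key n _ (hmem n), ← Polynomial.coeff_zero_eq_eval_zero,
      Polynomial.coeff_iterate_derivative] at h1
    simp only [zero_add, Nat.descFactorial_self, nsmul_eq_mul, mul_eq_zero, Nat.cast_eq_zero,
      Nat.factorial_ne_zero, false_or] at h1
    simpa using h1
  have h2 := eval_psi b x v 1 P
  rw [hpsi] at h2
  simpa [hv] using h2.symm


end poly

section inv
open Matrix

/-- `id + ε D` -/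
def dualHom {k R : Type*} [CommRing k] [CommRing R] [Algebra k R] (D : Derivation k R R) :
    R →+* TrivSqZeroExt R R where
  toFun Q := TrivSqZeroExt.inl Q + TrivSqZeroExt.inr (D Q)
  map_one' := by ext <;> simp
  map_mul' a c := by
    ext
    · simp
    · simp [Derivation.leibniz, mul_comm]
  map_zero' := by ext <;> simp
  map_add' a c := by ext <;> simp

lemma deriv_charpoly {k R n : Type*} [CommRing k] [CommRing R] [Algebra k R] [Fintype n]
    [DecidableEq n] (D : Derivation k R R) (A Z : Matrix n n R)
    (h : A.map D = Z * A - A * Z) (j : ℕ) : D (A.charpoly.coeff j) = 0 := by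
  let il : R →+* TrivSqZeroExt R R := TrivSqZeroExt.inlHom R R
  let Ai := A.map il
  let Ze : Matrix n n (TrivSqZeroExt R R) := Z.map TrivSqZeroExt.inr
  have inr_mul_il : ∀ (B C : Matrix n n R), B.map (TrivSqZeroExt.inr (R := R)) * C.map il
      = (B * C).map TrivSqZeroExt.inr := by
    intro B C
    ext p q
    · simp [Matrix.mul_apply, il, TrivSqZeroExt.fst_sum]
    · simp [Matrix.mul_apply, il, TrivSqZeroExt.snd_sum, mul_comm]
  have il_mul_inr : ∀ (B C : Matrix n n R), B.map il * C.map (TrivSqZeroExt.inr (R := R))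
      = (B * C).map TrivSqZeroExt.inr := by
    intro B C
    ext p q
    · simp [Matrix.mul_apply, il, TrivSqZeroExt.fst_sum]
    · simp [Matrix.mul_apply, il, TrivSqZeroExt.snd_sum, mul_comm]
  have inr_inr : ∀ (B C : Matrix n n R), B.map (TrivSqZeroExt.inr (R := R)) *
      C.map (TrivSqZeroExt.inr (R := R)) = 0 := by
    intro B C
    ext p q
    · simp [Matrix.mul_apply]
    · simp [Matrix.mul_apply]
  have hZ : Ze * Ze = 0 := inr_inr Z Z
  have hZA : Ze * Ai = (Z * A).map TrivSqZeroExt.inr := inr_mul_il Z A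
  have hAZ : Ai * Ze = (A * Z).map TrivSqZeroExt.inr := il_mul_inr A Z
  let U : (Matrix n n (TrivSqZeroExt R R))ˣ :=
    ⟨1 + Ze, 1 - Ze, by
      rw [add_mul, mul_sub, mul_sub, hZ]; simp, by
      rw [sub_mul, mul_add, mul_add, hZ]; simp⟩
  have h1 : A.map (dualHom D) = U.val * Ai * U⁻¹.val := by
    change A.map (dualHom D) = (1 + Ze) * Ai * (1 - Ze)
    have e : (1 + Ze) * Ai * (1 - Ze) = Ai + (Ze * Ai - Ai * Ze) - Ze * Ai * Ze := by
      noncomm_ring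
    rw [e, hZA, hAZ, inr_inr, sub_zero]
    ext p q
    · simp [dualHom, Ai, il]
    · have := congrFun (congrFun h p) q
      simp only [Matrix.map_apply, Matrix.sub_apply] at this
      simp [dualHom, Ai, il, this]
  have h2 : (A.map (dualHom D)).charpoly = Ai.charpoly := by
    rw [h1, Matrix.coe_units_inv]; exact Matrix.charpoly_units_conj U Ai
  have h3 : Ai.charpoly = A.charpoly.map il := Matrix.charpoly_map A il
  rw [Matrix.charpoly_map A (dualHom D), h3] at h2
  have h4 := congrArg (fun p => TrivSqZeroExt.snd (p.coeff j)) h2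
  simpa [dualHom, il] using h4

variable {k : Type*} [Field k] {g : Type*} [LieRing g] [LieAlgebra k g]
variable {ι : Type*} [Fintype ι] [DecidableEq ι] (b : Basis ι k g)

/-- generic matrix of `ad` -/
noncomputable def genMat : Matrix ι ι (MvPolynomial ι k) :=
  ∑ i, (X i : MvPolynomial ι k) • (LinearMap.toMatrix b b (ad k g (b i))).map C

lemma toMatrix_ad (y : g) : LinearMap.toMatrix b b (ad k g y) =
    ∑ i, b.repr y i • LinearMap.toMatrix b b (ad k g (b i)) := by
  conv_lhs => rw [← b.sum_repr y]
  simp only [map_sum, map_smul]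

lemma genMat_eval (y : g) :
    (genMat b).map (eval (b.repr y)) = LinearMap.toMatrix b b (ad k g y) := by
  rw [toMatrix_ad]
  ext p q
  simp [genMat, Matrix.sum_apply]

/-- coefficient polynomials -/
noncomputable def PP (j : ℕ) : MvPolynomial ι k := (genMat b).charpoly.coeff j

lemma PP_eval [FiniteDimensional k g] (j : ℕ) (y : g) :
    eval (b.repr y) (PP b j) = (ad k g y).charpoly.coeff j := by
  rw [← LinearMap.charpoly_toMatrix (ad k g y) b, ← genMat_eval, Matrix.charpoly_map,
    Polynomial.coeff_map]
  rfl

lemma dZ_PP (j : ℕ) (z : g) : dZ b z (PP b j) = 0 := by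
  apply deriv_charpoly (dZ b z) (genMat b) ((LinearMap.toMatrix b b (ad k g z)).map C)
  have key : ∀ j, ∑ i, b.repr ⁅z, b j⁆ i • LinearMap.toMatrix b b (ad k g (b i)) =
      LinearMap.toMatrix b b (ad k g z) * LinearMap.toMatrix b b (ad k g (b j)) -
      LinearMap.toMatrix b b (ad k g (b j)) * LinearMap.toMatrix b b (ad k g z) := by
    intro j
    rw [← toMatrix_ad, ← LinearMap.toMatrix_mul, ← LinearMap.toMatrix_mul, ← map_sub]
    congr 1
    ext u
    simp
  have e1 : (genMat b).map (dZ b z) = ∑ j, (X j : MvPolynomial ι k) •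
      (∑ i, b.repr ⁅z, b j⁆ i • LinearMap.toMatrix b b (ad k g (b i))).map C := by
    ext1 p q
    simp only [genMat, Matrix.map_apply, Matrix.sum_apply, Matrix.smul_apply, smul_eq_mul,
      map_sum, Derivation.leibniz, dZ_C, dZ_X, mul_zero, zero_add, map_mul, Finset.mul_sum]
    rw [Finset.sum_comm]
    exact Finset.sum_congr rfl fun _ _ => Finset.sum_congr rfl fun _ _ => by ring
  rw [e1, genMat, Finset.mul_sum, Finset.sum_mul, ← Finset.sum_sub_distrib]
  refine Finset.sum_congr rfl fun j _ => ?_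
  rw [key j, Matrix.map_sub C (map_sub C), Matrix.map_mul, Matrix.map_mul, smul_sub,
    Matrix.mul_smul, Matrix.smul_mul]

end inv

section dim
variable {k : Type*} [Field k] {V : Type*} [AddCommGroup V] [Module k V] [FiniteDimensional k V]

lemma finrank_map_add (S : End k V) (U : Submodule k V) :
    finrank k (U.map S) + finrank k (LinearMap.ker S ⊓ U : Submodule k V) = finrank k U := by
  have h := LinearMap.finrank_range_add_finrank_ker (S.domRestrict U)
  rw [LinearMap.range_domRestrict, LinearMap.ker_domRestrict] at h
  rw [← h, inf_comm, ← Submodule.map_comap_subtype, Submodule.finrank_map_subtype_eq]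

lemma ker_pow_finrank (T : End k V) :
    T.maxGenEigenspace 0 = LinearMap.ker (T ^ finrank k V) := by
  rw [Module.End.maxGenEigenspace_eq_genEigenspace_finrank]
  ext v
  simp [Module.End.mem_genEigenspace_nat]

lemma map_pow_le (T : End k V) (U0 U1 : Submodule k V)
    (h01 : ∀ v ∈ U0, T v ∈ U1) :
    finrank k (U0.map (T ^ finrank k V)) ≤ finrank k (U1.map (T ^ finrank k V)) := by
  set N := finrank k V with hN
  have hinj : ∀ u ∈ U0.map (T ^ N), T u = 0 → u = 0 := by
    rintro _ ⟨v, hv, rfl⟩ h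
    have h1 : v ∈ T.maxGenEigenspace 0 := by
      rw [Module.End.mem_maxGenEigenspace]
      refine ⟨N + 1, ?_⟩
      simpa [pow_succ'] using h
    rw [ker_pow_finrank] at h1
    exact h1
  have h2 := finrank_map_add T (U0.map (T ^ N))
  have h3 : (LinearMap.ker T ⊓ U0.map (T ^ N) : Submodule k V) = ⊥ := by
    rw [eq_bot_iff]
    rintro u ⟨hu, hu'⟩
    exact hinj u hu' hu
  rw [h3, finrank_bot, add_zero] at h2
  rw [← h2]
  apply Submodule.finrank_mono
  rintro _ ⟨_, ⟨v, hv, rfl⟩, rfl⟩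
  refine ⟨T v, h01 v hv, ?_⟩
  rw [← Module.End.mul_apply, ← Module.End.mul_apply, ← pow_succ, pow_succ']

lemma dim_lemma (T : End k V) (U0 U1 : Submodule k V)
    (h01 : ∀ v ∈ U0, T v ∈ U1) (h10 : ∀ v ∈ U1, T v ∈ U0) :
    finrank k (T.maxGenEigenspace 0 ⊓ U1 : Submodule k V) + finrank k U0 =
    finrank k (T.maxGenEigenspace 0 ⊓ U0 : Submodule k V) + finrank k U1 := by
  have a := map_pow_le T U0 U1 h01
  have c := map_pow_le T U1 U0 h10
  have d := finrank_map_add (T ^ finrank k V) U0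
  have e := finrank_map_add (T ^ finrank k V) U1
  rw [← ker_pow_finrank] at d e
  omega

lemma ss_decomp (T : End k V) (hT : T.IsSemisimple) (v : V) : ∃ a u, T a = 0 ∧ v = a + T u := by
  have hd : Disjoint (LinearMap.ker T) (LinearMap.range T) := by
    rw [Submodule.disjoint_def]
    rintro _ h ⟨u, rfl⟩
    have h1 : u ∈ T.genEigenspace 0 2 := by
      have := (Module.End.mem_genEigenspace_nat (f := T) (μ := 0) (k := 2) (x := u)).2
      apply this
      simpa [pow_two] using h
    have := hT.isFinitelySemisimple.genEigenspace_eq_eigenspace 0 (k := 2) (by norm_num)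
    rw [this, Module.End.mem_eigenspace_iff] at h1
    simpa using h1
  have ht : LinearMap.ker T ⊔ LinearMap.range T = ⊤ := by
    apply Submodule.eq_top_of_disjoint _ _ _ hd
    rw [add_comm, LinearMap.finrank_range_add_finrank_ker]
  have hv : v ∈ LinearMap.ker T ⊔ LinearMap.range T := ht ▸ Submodule.mem_top
  obtain ⟨a, ha, _, ⟨u, rfl⟩, rfl⟩ := Submodule.mem_sup.1 hv
  exact ⟨a, u, ha, rfl⟩
end dim

section generic
variable {k : Type*} [Field k] [IsAlgClosed k] [CharZero k]
  {g : Type*} [LieRing g] [LieAlgebra k g] [FiniteDimensional k g] [LieAlgebra.IsKilling k g]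

lemma exists_engel_le (H : LieSubalgebra k g) [H.IsCartanSubalgebra] :
    ∃ h ∈ H, LieSubalgebra.engel k h ≤ H := by
  obtain ⟨h, hh⟩ := Module.Dual.exists_forall_ne_zero_of_forall_exists (K := k) (M := H)
    (ι := {α : LieModule.Weight k H g // α.IsNonZero})
    (fun α => LieModule.Weight.toLinear k H g α.1) (by
      rintro ⟨α, hα⟩
      by_contra! hc
      exact hα (funext hc))
  refine ⟨h, h.2, ?_⟩
  let N : LieSubmodule k H g :=
    { (LieSubalgebra.engel k (h : g)).toSubmodule with
      lie_mem := by
        intro a u hu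
        have ha : (a : g) ∈ LieSubalgebra.engel k (h : g) := by
          rw [LieSubalgebra.mem_engel_iff]
          refine ⟨1, ?_⟩
          have : ⁅h, a⁆ = 0 := trivial_lie_zero H H h a
          simpa using congrArg (Subtype.val) this
        exact (LieSubalgebra.engel k (h : g)).lie_mem ha hu }
  have hN := LieModule.eq_iSup_inf_genWeightSpace (K := k) (L := H) (M := g) (N := N)
  have hle : N ≤ H.toLieSubmodule := by
    refine hN.le.trans (iSup_le fun α => ?_)
    by_cases hα : α.IsZero
    · rw [show LieModule.genWeightSpace g (α : H → k) = H.toLieSubmodule by ext; simp [hα.eq]]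
      exact inf_le_right
    · rintro u ⟨hu1, hu2⟩
      have h1 := LieAlgebra.IsKilling.lie_eq_smul_of_mem_rootSpace hu2 h
      have h0 : α h ≠ 0 := hh ⟨α, hα⟩
      obtain ⟨n, hn⟩ := (LieSubalgebra.mem_engel_iff k _ _).1
        (show u ∈ LieSubalgebra.engel k (h : g) from hu1)
      have h2 : ∀ n : ℕ, ((ad k g (h : g)) ^ n) u = (α h) ^ n • u := by
        intro n
        induction n with
        | zero => simp
        | succ n ih =>
          rw [pow_succ', Module.End.mul_apply, ih, map_smul, pow_succ, mul_smul]
          congr 1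
      rw [h2] at hn
      have : u = 0 := (smul_eq_zero.1 hn).resolve_left (pow_ne_zero _ h0)
      rw [this]
      exact zero_mem _
  intro u hu
  exact hle (show u ∈ N from hu)

lemma exists_eval (y : g) (r : ℕ) (h : (ad k g y).charpoly.coeff r ≠ 0) :
    finrank k (LieSubalgebra.engel k y) ≤ r := by
  rw [LieAlgebra.finrank_engel]
  exact Polynomial.natTrailingDegree_le_of_ne_zero h

lemma coeff_engel (y : g) : (ad k g y).charpoly.coeff (finrank k (LieSubalgebra.engel k y)) ≠ 0 := by
  rw [LieAlgebra.finrank_engel]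
  have := Polynomial.trailingCoeff_nonzero_iff_nonzero.2 (LinearMap.charpoly_monic (ad k g y)).ne_zero
  exact this
end generic

section main
variable {k : Type*} [Field k] [IsAlgClosed k] [CharZero k]
  {g : Type*} [LieRing g] [LieAlgebra k g] [FiniteDimensional k g] [LieAlgebra.IsKilling k g]

lemma mem_eig (σ : g ≃ₗ⁅k⁆ g) (c : k) (y : g) : y ∈ eigSub k g σ c ↔ σ y = c • y := by
  unfold eigSub
  rw [Module.End.mem_eigenspace_iff]
  rfl

lemma mem_zg (x y : g) : y ∈ zg k g x ↔ ⁅x, y⁆ = 0 := Iff.rfl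

lemma mem_one (σ : g ≃ₗ⁅k⁆ g) (y : g) : y ∈ eigSub k g σ 1 ↔ σ y = y := by
  rw [mem_eig, one_smul]

lemma mem_neg (σ : g ≃ₗ⁅k⁆ g) (y : g) : y ∈ eigSub k g σ (-1) ↔ σ y = -y := by
  rw [mem_eig, neg_one_smul]

lemma sig_add (σ : g ≃ₗ⁅k⁆ g) (a c : g) : σ (a + c) = σ a + σ c := σ.toLieHom.map_add a c
lemma sig_sub (σ : g ≃ₗ⁅k⁆ g) (a c : g) : σ (a - c) = σ a - σ c := σ.toLieHom.map_sub a c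
lemma sig_neg (σ : g ≃ₗ⁅k⁆ g) (a : g) : σ (-a) = -σ a := σ.toLieHom.map_neg a
lemma sig_smul (σ : g ≃ₗ⁅k⁆ g) (t : k) (a : g) : σ (t • a) = t • σ a := σ.toLieHom.map_smul t a

lemma half_add {k : Type*} [Field k] [CharZero k] {g : Type*} [LieRing g] [LieAlgebra k g] (a : g) : (2⁻¹ : k) • (a + a) = a := by
  rw [← two_smul k a, smul_smul, inv_mul_cancel₀ two_ne_zero, one_smul]

lemma eq_zero_of_eq_neg (k : Type*) [Field k] [CharZero k] {g : Type*} [LieRing g] [LieAlgebra k g]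
    (a : g) (h : a = -a) : a = 0 := by
  have : a + a = 0 := by nth_rewrite 1 [h]; simp
  rw [← half_add (k := k) a, this, smul_zero]

lemma slice (σ : g ≃ₗ⁅k⁆ g) (hσ : IsInvolution k g σ) (x : g) (hx : σ x = -x)
    (hss : IsSSElt k g x) (v : g) (hv : v ∈ eigSub k g σ (-1)) :
    ∃ w ∈ (zg k g x).toSubmodule ⊓ eigSub k g σ (-1), ∃ z ∈ (eigSub k g σ 1 : Set g),
      v = w + ⁅z, x⁆ := by
  obtain ⟨a, u, ha, hau⟩ := ss_decomp (ad k g x) hss v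
  rw [mem_neg] at hv
  simp only [ad_apply] at ha hau
  have hsa : ⁅x, σ a⁆ = 0 := by
    have := congrArg σ ha
    rw [LieEquiv.map_lie, hx, neg_lie] at this
    rw [← neg_eq_zero, this]
    exact σ.toLieHom.map_zero
  refine ⟨(2⁻¹ : k) • (a - σ a), ⟨?_, ?_⟩, -((2⁻¹ : k) • (u + σ u)), ?_, ?_⟩
  · change ⁅x, _⁆ = 0
    rw [lie_smul, lie_sub, ha, hsa, sub_zero, smul_zero]
  · change _ ∈ eigSub k g σ (-1)
    rw [mem_neg, sig_smul, sig_sub, hσ, ← smul_neg, neg_sub]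
  · change _ ∈ eigSub k g σ 1
    rw [mem_one, sig_neg, sig_smul, sig_add, hσ, add_comm]
  · rw [neg_lie, lie_skew, lie_smul, ← smul_add, lie_add]
    have h1 : σ v = σ a - ⁅x, σ u⁆ := by
      rw [hau, sig_add, LieEquiv.map_lie, hx, neg_lie, sub_eq_add_neg]
    rw [hv] at h1
    have h2 : a - σ a + (⁅x, u⁆ + ⁅x, σ u⁆) = v + v := by
      have : v + v = v - (-v) := by abel
      rw [this, h1, hau]; abel
    rw [h2, half_add]

lemma lie_00 (σ : g ≃ₗ⁅k⁆ g) {a c : g} (ha : σ a = -a) (hc : σ c = -c) : σ ⁅a, c⁆ = ⁅a, c⁆ := by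
  rw [LieEquiv.map_lie, ha, hc, neg_lie, lie_neg, neg_neg]

lemma lie_01 (σ : g ≃ₗ⁅k⁆ g) {a c : g} (ha : σ a = a) (hc : σ c = -c) : σ ⁅a, c⁆ = -⁅a, c⁆ := by
  rw [LieEquiv.map_lie, ha, hc, lie_neg]

lemma lie_10 (σ : g ≃ₗ⁅k⁆ g) {a c : g} (ha : σ a = -a) (hc : σ c = c) : σ ⁅a, c⁆ = -⁅a, c⁆ := by
  rw [LieEquiv.map_lie, ha, hc, neg_lie]

lemma dim_eq (σ : g ≃ₗ⁅k⁆ g) (y : g) (hy : σ y = -y) :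
    finrank k ((LieSubalgebra.engel k y).toSubmodule ⊓ eigSub k g σ (-1) : Submodule k g) +
      finrank k (eigSub k g σ 1) =
    finrank k ((LieSubalgebra.engel k y).toSubmodule ⊓ eigSub k g σ 1 : Submodule k g) +
      finrank k (eigSub k g σ (-1)) := by
  refine dim_lemma (ad k g y) _ _ ?_ ?_
  · intro v hv
    rw [mem_one] at hv
    rw [mem_neg]
    exact lie_10 σ hy hv
  · intro v hv
    rw [mem_neg] at hv
    rw [mem_one]
    exact lie_00 σ hy hv

lemma eig_disj (σ : g ≃ₗ⁅k⁆ g) : eigSub k g σ (-1) ⊓ eigSub k g σ 1 = ⊥ := by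
  rw [eq_bot_iff]
  rintro a ⟨h1, h2⟩
  have h1' := (mem_neg σ a).1 h1
  have h2' := (mem_one σ a).1 h2
  exact eq_zero_of_eq_neg k a (h2'.symm.trans h1')

lemma exists_good (σ : g ≃ₗ⁅k⁆ g) (hσ : IsInvolution k g σ)
    (hmax : IsMaxRank k g σ) (x : g) (hx : x ∈ eigSub k g σ (-1)) (hss : IsSSElt k g x) :
    ∃ y ∈ zg k g x, (LieSubalgebra.engel k y).toSubmodule ≤ eigSub k g σ (-1) := by
  obtain ⟨H, hH, hle⟩ := hmax
  obtain ⟨h, hhH, hEH⟩ := exists_engel_le H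
  have hx' := (mem_neg σ x).1 hx
  have hh' : σ h = -h := (mem_neg σ h).1 (hle hhH)
  set r := finrank k (LieSubalgebra.engel k h) with hr
  have hE1 : (LieSubalgebra.engel k h).toSubmodule ≤ eigSub k g σ (-1) :=
    le_trans hEH hle
  have d1 := dim_eq σ h hh'
  rw [inf_eq_left.2 hE1] at d1
  have hbot : ((LieSubalgebra.engel k h).toSubmodule ⊓ eigSub k g σ 1 : Submodule k g) = ⊥ := by
    rw [eq_bot_iff, ← eig_disj σ]
    exact inf_le_inf_right _ hE1
  rw [hbot, finrank_bot, zero_add] at d1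
  let b := Module.finBasis k g
  have key : ∃ y ∈ (zg k g x).toSubmodule ⊓ eigSub k g σ (-1),
      (ad k g y).charpoly.coeff r ≠ 0 := by
    by_contra! hc
    have := vanish_of_vanish_slice b (eigSub k g σ (-1))
      ((zg k g x).toSubmodule ⊓ eigSub k g σ (-1)) (eigSub k g σ 1 : Set g) x (PP b r)
      inf_le_right ⟨lie_self x, hx⟩ (slice σ hσ x hx' hss) (fun z _ => dZ_PP b r z)
      (fun z hz v hv => (mem_neg σ _).2 (lie_01 σ ((mem_one σ _).1 hz) ((mem_neg σ _).1 hv)))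
      (fun y hy => by rw [PP_eval]; exact hc y hy) h (hle hhH)
    rw [PP_eval] at this
    exact coeff_engel h this
  obtain ⟨y, ⟨hy1, hy2⟩, hyr⟩ := key
  refine ⟨y, hy1, ?_⟩
  have hy' : σ y = -y := (mem_neg σ y).1 hy2
  have hEr := exists_eval y r hyr
  have d2 := dim_eq σ y hy'
  have d3 : finrank k ((LieSubalgebra.engel k y).toSubmodule ⊓ eigSub k g σ (-1) : Submodule k g)
      ≤ finrank k (LieSubalgebra.engel k y).toSubmodule := Submodule.finrank_mono inf_le_left
  have d4 : finrank k (LieSubalgebra.engel k y).toSubmodule ≤ r := hEr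
  have d5 : finrank k (LieSubalgebra.engel k h).toSubmodule = r := rfl
  rw [d5] at d1
  have e := Submodule.eq_of_le_of_finrank_le (S₁ := (LieSubalgebra.engel k y).toSubmodule ⊓
    eigSub k g σ (-1)) (S₂ := (LieSubalgebra.engel k y).toSubmodule) inf_le_left (by omega)
  exact inf_eq_left.1 e

lemma comm_of_le (σ : g ≃ₗ⁅k⁆ g) (E : LieSubalgebra k g)
    (h : E.toSubmodule ≤ eigSub k g σ (-1)) (a c : g) (ha : a ∈ E) (hc : c ∈ E) : ⁅a, c⁆ = 0 := by
  have h1 := (mem_neg σ _).1 (h (E.lie_mem ha hc))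
  have h2 := lie_00 σ ((mem_neg σ _).1 (h ha)) ((mem_neg σ _).1 (h hc))
  exact eq_zero_of_eq_neg k _ (h2.symm.trans h1)
end main

section derived
variable {k : Type*} [Field k] [IsAlgClosed k] [CharZero k]
  {g : Type*} [LieRing g] [LieAlgebra k g] [FiniteDimensional k g] [LieAlgebra.IsKilling k g]

lemma nilp_of_inj {L : Type*} [LieRing L] [LieAlgebra k L] (φ : L →ₗ⁅k⁆ g)
    (hφ : Function.Injective φ) (E : LieSubalgebra k g)
    (hE : ∀ a ∈ E, ∀ c ∈ E, ⁅a, c⁆ = 0) : LieRing.IsNilpotent (E.comap φ) := by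
  have : IsLieAbelian (E.comap φ) := ⟨by
    rintro ⟨a, ha⟩ ⟨c, hc⟩
    apply Subtype.ext
    apply hφ
    change φ ⁅a, c⁆ = φ 0
    rw [LieHom.map_lie, map_zero]
    exact hE _ ha _ hc⟩
  infer_instance

lemma cartan_of_inj {L : Type*} [LieRing L] [LieAlgebra k L] (φ : L →ₗ⁅k⁆ g)
    (hφ : Function.Injective φ) (y : g)
    (hE : ∀ a ∈ LieSubalgebra.engel k y, ∀ c ∈ LieSubalgebra.engel k y, ⁅a, c⁆ = 0)
    (hn : ∀ n : L, (∀ a : L, φ a ∈ LieSubalgebra.engel k y →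
      ⁅φ n, φ a⁆ ∈ LieSubalgebra.engel k y) → ⁅φ n, y⁆ ∈ LieSubalgebra.engel k y) :
    ((LieSubalgebra.engel k y).comap φ).IsCartanSubalgebra where
  nilpotent := nilp_of_inj φ hφ _ hE
  self_normalizing := by
    apply le_antisymm _ (LieSubalgebra.le_normalizer _)
    intro n hn'
    rw [LieSubalgebra.mem_normalizer_iff] at hn'
    have h1 := hn n (fun a ha => by
      have := hn' a ha
      change φ ⁅n, a⁆ ∈ LieSubalgebra.engel k y at this
      rwa [LieHom.map_lie] at this)
    rw [← lie_skew, neg_mem_iff (G := g), LieSubalgebra.mem_engel_iff] at h1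
    obtain ⟨m, hm⟩ := h1
    change φ n ∈ LieSubalgebra.engel k y
    rw [LieSubalgebra.mem_engel_iff]
    refine ⟨m + 1, ?_⟩
    rw [pow_succ, Module.End.mul_apply]
    exact hm

lemma mem_engel_of_comm (y a : g) (h : ⁅y, a⁆ = 0) : a ∈ LieSubalgebra.engel k y := by
  rw [LieSubalgebra.mem_engel_iff]
  exact ⟨1, by simpa using h⟩

lemma nondeg_l (x : g) (hss : IsSSElt k g x) (m : g) (hm : m ∈ zg k g x)
    (h : ∀ c ∈ zg k g x, killingForm k g m c = 0) : m = 0 := by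
  apply (LieAlgebra.IsKilling.killingForm_nondegenerate k g).1 m
  intro v
  obtain ⟨a, u, ha, hau⟩ := ss_decomp (ad k g x) hss v
  simp only [ad_apply] at ha hau
  have hmx : ⁅m, x⁆ = 0 := by
    rw [← lie_skew, (mem_zg x m).1 hm, neg_zero]
  have h1 : killingForm k g m ⁅x, u⁆ = 0 := by
    have := LieModule.traceForm_apply_lie_apply k g g m x u
    rw [hmx] at this
    simpa using this.symm
  rw [hau, map_add, h a ha, h1, add_zero]

lemma ad_nilp (l : LieSubalgebra k g) (m : l) (hmD : m ∈ LieAlgebra.derivedSeries k l 1)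
    (hmZ : ∀ a : l, ⁅a, m⁆ = 0) : IsNilpotent (ad k g (m : g)) := by
  have hμ : ∀ μ : k, μ ≠ 0 → (ad k g (m : g)).maxGenEigenspace μ = ⊥ := by
    intro μ hμ0
    let U : LieSubmodule k l g :=
      { (ad k g (m : g)).eigenspace μ with
        lie_mem := by
          intro a u hu
          change u ∈ (ad k g (m : g)).eigenspace μ at hu
          change ⁅(a : g), u⁆ ∈ (ad k g (m : g)).eigenspace μ
          rw [Module.End.mem_eigenspace_iff] at hu ⊢
          simp only [ad_apply] at hu ⊢
          have h0 : ⁅(a : g), (m : g)⁆ = 0 := congrArg Subtype.val (hmZ a)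
          have h0' : ⁅(m : g), (a : g)⁆ = 0 := by rw [← lie_skew, h0, neg_zero]
          rw [leibniz_lie, h0', zero_lie, zero_add, hu, lie_smul] }
    have ht := LieModule.trace_toEnd_eq_zero_of_mem_lcs k l U (k := 1) (x := m) le_rfl hmD
    have he : LieModule.toEnd k l U m = μ • LinearMap.id := by
      ext ⟨u, hu⟩
      have hu' : u ∈ (ad k g (m : g)).eigenspace μ := hu
      rw [Module.End.mem_eigenspace_iff] at hu'
      exact hu'
    rw [he, map_smul, LinearMap.trace_id, smul_eq_mul] at ht
    have hf : finrank k U = 0 := by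
      have := (mul_eq_zero.1 ht).resolve_left hμ0
      exact_mod_cast this
    have hb : (ad k g (m : g)).eigenspace μ = ⊥ := Submodule.finrank_eq_zero.1 hf
    by_contra hne
    have h1 : (ad k g (m : g)).HasUnifEigenvalue μ ⊤ := hne
    exact h1.lt zero_lt_one hb
  have htop := Module.End.iSup_maxGenEigenspace_eq_top (ad k g (m : g))
  have h0 : (ad k g (m : g)).maxGenEigenspace 0 = ⊤ := by
    rw [eq_top_iff, ← htop]
    refine iSup_le fun μ => ?_
    by_cases h : μ = 0
    · rw [h]
    · rw [hμ μ h]; exact bot_le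
  rw [ker_pow_finrank, LinearMap.ker_eq_top] at h0
  exact ⟨_, h0⟩

lemma decomp_l (x y : g) (hss : IsSSElt k g x) (hy : y ∈ zg k g x)
    [(LieSubalgebra.engel k y).IsCartanSubalgebra] (u : zg k g x) :
    ∃ z d : zg k g x, (∀ a : zg k g x, ⁅a, z⁆ = 0) ∧ d ∈ LieAlgebra.derivedSeries k (zg k g x) 1 ∧
      u = z + d := by
  let B : LinearMap.BilinForm k (zg k g x) := LieModule.traceForm k (zg k g x) g
  let D : Submodule k (zg k g x) := (LieAlgebra.derivedSeries k (zg k g x) 1).toSubmodule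
  have hZ : ∀ m ∈ B.orthogonal D, ∀ a : zg k g x, ⁅a, m⁆ = 0 := by
    intro m hm a
    apply Subtype.ext
    apply nondeg_l x hss _ (⁅a, m⁆ : zg k g x).2
    intro c hc
    change B ⁅a, m⁆ ⟨c, hc⟩ = 0
    have h1 : B ⁅a, m⁆ ⟨c, hc⟩ = B ⁅(⟨c, hc⟩ : zg k g x), a⁆ m := by
      rw [show B ⁅a, m⁆ ⟨c, hc⟩ = B ⟨c, hc⟩ ⁅a, m⁆ from LieModule.traceForm_comm ..]
      exact (LieModule.traceForm_apply_lie_apply ..).symm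
    rw [h1]
    refine hm _ ?_
    exact LieSubmodule.lie_mem_lie (LieSubmodule.mem_top _) (LieSubmodule.mem_top _)
  have hd : Disjoint D (B.orthogonal D) := by
    rw [Submodule.disjoint_def]
    intro m hmD hm
    have hz := hZ m hm
    have hn := ad_nilp (zg k g x) m hmD hz
    have hmE : (m : g) ∈ LieSubalgebra.engel k y :=
      mem_engel_of_comm y m (congrArg Subtype.val (hz ⟨y, hy⟩))
    exact Subtype.ext
      (LieAlgebra.IsKilling.eq_zero_of_isNilpotent_ad_of_mem_isCartanSubalgebra k g _ hmE hn)
  have hr : B.IsRefl := (LieModule.traceForm_isSymm k (zg k g x) g).isRefl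
  have hc := (LinearMap.BilinForm.isCompl_orthogonal_iff_disjoint hr).2 hd
  have hu : u ∈ D ⊔ B.orthogonal D := hc.sup_eq_top ▸ Submodule.mem_top
  obtain ⟨d, hdD, z, hz, rfl⟩ := Submodule.mem_sup.1 hu
  exact ⟨z, d, hZ z hz, hdD, add_comm _ _⟩
end derived

end MaxRankAux

/-- If `σ` is an involution of maximal rank and `x ∈ g₁` is semisimple,
then the centralizer `z_g(x)` is `σ`-stable, the restriction of `σ` to `z_g(x)` is again of
maximal rank, and so is its restriction to the derived subalgebra `[z_g(x), z_g(x)]`. -/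
theorem maxRank_restriction_to_centralizer (σ : g ≃ₗ⁅k⁆ g) (hσ : IsInvolution k g σ)
    (hmax : IsMaxRank k g σ) (x : g) (hx : x ∈ eigSub k g σ (-1)) (hss : IsSSElt k g x) :
    (∀ y ∈ zg k g x, σ y ∈ zg k g x) ∧
    (∃ H : LieSubalgebra k (zg k g x), H.IsCartanSubalgebra ∧
      ∀ y ∈ H, σ (y : g) = -(y : g)) ∧
    (∃ H : LieSubalgebra k (LieAlgebra.derivedSeries k (zg k g x) 1),
      H.IsCartanSubalgebra ∧
      ∀ y ∈ H, σ ((y : (zg k g x)) : g) = -((y : (zg k g x)) : g)) := by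
  have : LieAlgebra.IsKilling k g := inferInstance
  have hx' := (MaxRankAux.mem_neg σ x).1 hx
  obtain ⟨y, hy, hyE⟩ := MaxRankAux.exists_good σ hσ hmax x hx hss
  have hab : ∀ a ∈ LieSubalgebra.engel k y, ∀ c ∈ LieSubalgebra.engel k y, ⁅a, c⁆ = 0 :=
    fun a ha c hc => MaxRankAux.comm_of_le σ _ hyE a c ha hc
  have hyx : ⁅y, x⁆ = 0 := by rw [← lie_skew, (MaxRankAux.mem_zg x y).1 hy, neg_zero]
  have hyy : y ∈ LieSubalgebra.engel k y := LieSubalgebra.self_mem_engel k y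
  have hxE : x ∈ LieSubalgebra.engel k y := MaxRankAux.mem_engel_of_comm y x hyx
  have hC : (LieSubalgebra.engel k y).IsCartanSubalgebra :=
    { nilpotent := by
        have : IsLieAbelian (LieSubalgebra.engel k y) := ⟨by
          rintro ⟨a, ha⟩ ⟨c, hc⟩
          exact Subtype.ext (hab a ha c hc)⟩
        infer_instance
      self_normalizing := LieSubalgebra.normalizer_engel k y }
  refine ⟨?_, ⟨(LieSubalgebra.engel k y).comap (zg k g x).incl, ?_, ?_⟩,
    ⟨(LieSubalgebra.engel k y).comap
      ((zg k g x).incl.comp (LieAlgebra.derivedSeries k (zg k g x) 1).incl), ?_, ?_⟩⟩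
  · intro u hu
    rw [MaxRankAux.mem_zg] at hu ⊢
    have h := congrArg σ hu
    rw [LieEquiv.map_lie, hx', neg_lie] at h
    rw [← neg_eq_zero, h]
    exact σ.toLieHom.map_zero
  · refine MaxRankAux.cartan_of_inj _ Subtype.val_injective y hab ?_
    intro n hn
    exact hn ⟨y, hy⟩ hyy
  · intro u hu
    exact (MaxRankAux.mem_neg σ _).1 (hyE hu)
  · refine MaxRankAux.cartan_of_inj _
      (Subtype.val_injective.comp Subtype.val_injective) y hab ?_
    intro n hn
    obtain ⟨z, d, hz, hd, hzd⟩ := MaxRankAux.decomp_l x y hss hy ⟨y, hy⟩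
    have hzd' : y = (z : g) + (d : g) := congrArg Subtype.val hzd
    have hzE : (z : g) ∈ LieSubalgebra.engel k y :=
      MaxRankAux.mem_engel_of_comm y z (congrArg Subtype.val (hz ⟨y, hy⟩))
    have hdE : (d : g) ∈ LieSubalgebra.engel k y := by
      have : (d : g) = y - z := by rw [eq_sub_iff_add_eq, add_comm]; exact hzd'.symm
      rw [this]
      exact sub_mem hyy hzE
    have h1 := hn ⟨d, hd⟩ hdE
    have h2 : ⁅((n : zg k g x) : g), (z : g)⁆ = 0 := congrArg Subtype.val (hz n)
    have h3 : ⁅((n : zg k g x) : g), y⁆ = ⁅((n : zg k g x) : g), (d : g)⁆ := by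
      nth_rewrite 1 [hzd']
      rw [lie_add, h2, zero_add]
    change ⁅((n : zg k g x) : g), y⁆ ∈ _
    rw [h3]
    exact h1
  · intro u hu
    exact (MaxRankAux.mem_neg σ _).1 (hyE hu)
end
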